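/- arXiv:2211.13821 — 10 statements merged into one kernel-verified Lean document; each statement's English description precedes it below -/
import Mathlib

section
/- Let (X_n)_{n∈ℕ} be nonempty compact metric spaces and g_n : X_n → X_{n+1} non-expansive surjections. Then the direct system they generate has an inductive limit in cmn: there exist a nonempty compact metric space X and non-expansive surjections f_n : X_n → X with f_{n+1} ∘ g_n = f_n for all n, such that for every nonempty compact metric space Z and every family of non-expansive maps h_n : X_n → Z with h_{n+1} ∘ g_n = h_n for all n, there is a unique non-expansive map ν : X → Z with ν ∘ f_n = h_n for all n. Moreover, the sequence toGHSpace X_n converges in GHSpace to toGHSpace X; in particular the limit object depends, up to isometry, only on the spaces X_n and not on the choice of the surjective arrows g_n. -/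
open GromovHausdorff Filter Topology

/-- A map between metric spaces is non-expansive. -/
def IsNonexpansive {X Y : Type} [MetricSpace X] [MetricSpace Y] (f : X → Y) : Prop :=
  ∀ a b : X, dist (f a) (f b) ≤ dist a b

theorem IsNonexpansive.continuous {A B : Type} [MetricSpace A] [MetricSpace B] {f : A → B}
    (hf : IsNonexpansive f) : Continuous f :=
  (LipschitzWith.of_dist_le_mul (K := 1) fun x y => by simpa using hf x y).continuous

/-- A pseudometric bounded by the distance of a compact metric space is realized by a
surjection onto a compact metric space. -/
theorem exists_compact_metric_quotient {A : Type} [MetricSpace A] [CompactSpace A]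
    (d : A → A → ℝ) (d_self : ∀ x, d x x = 0) (d_comm : ∀ x y, d x y = d y x)
    (d_triangle : ∀ x y z, d x z ≤ d x y + d y z) (d_le : ∀ x y, d x y ≤ dist x y) :
    ∃ (L : Type) (_ : MetricSpace L) (_ : CompactSpace L) (π : A → L),
      Function.Surjective π ∧ ∀ x y, dist (π x) (π y) = d x y := by
  have key : ∀ P : PseudoMetricSpace A, ∃ (L : Type) (_ : MetricSpace L) (π : A → L),
      Function.Surjective π ∧ ∀ x y, dist (π x) (π y) = P.dist x y := fun P =>
    ⟨@SeparationQuotient A P.toUniformSpace.toTopologicalSpace, inferInstance,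
      SeparationQuotient.mk, SeparationQuotient.surjective_mk, SeparationQuotient.dist_mk⟩
  obtain ⟨L, hL, π, hπ, hd⟩ := key
    { dist := d, dist_self := d_self, dist_comm := d_comm, dist_triangle := d_triangle }
  have hc : Continuous π :=
    IsNonexpansive.continuous fun x y => (hd x y).trans_le (d_le x y)
  exact ⟨L, hL, ⟨hπ.range_eq ▸ isCompact_range hc⟩, π, hπ, hd⟩

/-- A surjection between compact metric spaces that distorts distances by at most `ε` bounds
the Gromov-Hausdorff distance. -/
theorem ghDist_le_of_surjective_distortion {A B : Type} [MetricSpace A] [MetricSpace B]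
    [CompactSpace A] [CompactSpace B] [Nonempty A] [Nonempty B] {ε : ℝ}
    (f : A → B) (hf : Function.Surjective f)
    (hε : ∀ x y, |dist x y - dist (f x) (f y)| ≤ ε) :
    ghDist A B ≤ ε / 2 := by
  have := ghDist_le_of_approx_subsets (s := (Set.univ : Set A)) (fun x => f x)
    (ε₁ := 0) (ε₂ := ε) (ε₃ := 0) (fun x => ⟨x, trivial, by simp⟩)
    (fun y => by obtain ⟨x, rfl⟩ := hf y; exact ⟨⟨x, trivial⟩, by simp⟩)
    (fun x y => hε x y)
  linarith

/-- The composite `X 0 → X n` of the arrows of a direct system. -/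
def transitionFromZero {X : ℕ → Type} (g : ∀ n, X n → X (n + 1)) : ∀ n, X 0 → X n
  | 0 => id
  | n + 1 => g n ∘ transitionFromZero g n

theorem transitionFromZero_surjective {X : ℕ → Type} {g : ∀ n, X n → X (n + 1)}
    (hg : ∀ n, Function.Surjective (g n)) : ∀ n, Function.Surjective (transitionFromZero g n)
  | 0 => Function.surjective_id
  | n + 1 => (hg n).comp (transitionFromZero_surjective hg n)

theorem comp_transitionFromZero {X : ℕ → Type} {g : ∀ n, X n → X (n + 1)} {Z : Type}
    {h : ∀ n, X n → Z} (hh : ∀ n, h (n + 1) ∘ g n = h n) (n : ℕ) (x : X 0) :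
    h n (transitionFromZero g n x) = h 0 x := by
  induction n with
  | zero => rfl
  | succ n ih => rw [← ih]; exact congrFun (hh n) _

theorem antitone_dist_transitionFromZero {X : ℕ → Type} [∀ n, MetricSpace (X n)]
    {g : ∀ n, X n → X (n + 1)} (hg : ∀ n, IsNonexpansive (g n)) (x y : X 0) :
    Antitone fun n => dist (transitionFromZero g n x) (transitionFromZero g n y) :=
  antitone_nat_of_succ_le fun n => hg n _ _

theorem continuous_transitionFromZero {X : ℕ → Type} [∀ n, MetricSpace (X n)]
    {g : ∀ n, X n → X (n + 1)} (hg : ∀ n, IsNonexpansive (g n)) (n : ℕ) :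
    Continuous (transitionFromZero g n) :=
  IsNonexpansive.continuous fun x y => antitone_dist_transitionFromZero hg x y (Nat.zero_le n)

/-- **Theorem (inductive limits of ℕ-indexed direct systems in cmn).**
Given nonempty compact metric spaces `X n` and non-expansive surjections
`g n : X n → X (n+1)`, the generated direct system has an inductive limit in the
category of nonempty compact metric spaces with non-expansive maps; moreover the
sequence `toGHSpace (X n)` converges in the Gromov–Hausdorff space to the class of
the limit object (so the limit object depends only on the spaces, up to isometry). -/
theorem inductive_limit_of_nat_direct_system
    (X : ℕ → Type) [∀ n, MetricSpace (X n)] [∀ n, CompactSpace (X n)] [∀ n, Nonempty (X n)]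
    (g : ∀ n, X n → X (n + 1))
    (hg_ne : ∀ n, IsNonexpansive (g n))
    (hg_surj : ∀ n, Function.Surjective (g n)) :
    ∃ (L : Type) (_ : MetricSpace L) (_ : CompactSpace L) (_ : Nonempty L)
      (f : ∀ n, X n → L),
      (∀ n, IsNonexpansive (f n)) ∧
      (∀ n, Function.Surjective (f n)) ∧
      (∀ n, (f (n + 1)) ∘ (g n) = f n) ∧
      (∀ (Z : Type) (_ : MetricSpace Z) (_ : CompactSpace Z) (_ : Nonempty Z)
        (h : ∀ n, X n → Z),
        (∀ n, IsNonexpansive (h n)) →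
        (∀ n, (h (n + 1)) ∘ (g n) = h n) →
        ∃! ν : L → Z, IsNonexpansive ν ∧ ∀ n, ν ∘ (f n) = h n) ∧
      Tendsto (fun n => toGHSpace (X n)) atTop (𝓝 (toGHSpace L)) := by
  let p := transitionFromZero g
  have hp : ∀ n, Function.Surjective (p n) := transitionFromZero_surjective hg_surj
  let d : X 0 → X 0 → ℝ := fun x y => ⨅ n, dist (p n x) (p n y)
  have hbdd : ∀ x y, BddBelow (Set.range fun n => dist (p n x) (p n y)) := fun x y =>
    ⟨0, by rintro _ ⟨n, rfl⟩; exact dist_nonneg⟩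
  have hd_le : ∀ n x y, d x y ≤ dist (p n x) (p n y) := fun n x y => ciInf_le (hbdd x y) n
  have hlim : ∀ x y, Tendsto (fun n => dist (p n x) (p n y)) atTop (𝓝 (d x y)) := fun x y =>
    tendsto_atTop_ciInf (antitone_dist_transitionFromZero hg_ne x y) (hbdd x y)
  obtain ⟨L, hL, hLc, π, hπ, hπd⟩ := exists_compact_metric_quotient d
    (fun x => by simp [d]) (fun x y => by simp [d, dist_comm])
    (fun x y z => le_of_tendsto_of_tendsto' (hlim x z) ((hlim x y).add (hlim y z))
      fun n => dist_triangle _ _ _)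
    (hd_le 0)
  have hπc : Continuous π :=
    IsNonexpansive.continuous fun x y => (hπd x y).trans_le (hd_le 0 x y)
  have hLn : Nonempty L := Nonempty.map π inferInstance
  let f : ∀ n, X n → L := fun n y => π (Function.surjInv (hp n) y)
  have hfp : ∀ n x, f n (p n x) = π x := fun n x => by
    refine dist_le_zero.1 ?_
    calc dist (f n (p n x)) (π x)
        ≤ dist (p n (Function.surjInv (hp n) (p n x))) (p n x) :=
          (hπd _ _).trans_le (hd_le n _ _)
      _ = 0 := by rw [Function.surjInv_eq (hp n), dist_self]
  have hf_dist : ∀ n x y, dist (f n (p n x)) (f n (p n y)) = d x y := fun n x y => by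
    rw [hfp, hfp, hπd]
  have hf_surj : ∀ n, Function.Surjective (f n) := fun n z => by
    obtain ⟨x, rfl⟩ := hπ z
    exact ⟨p n x, hfp n x⟩
  refine ⟨L, hL, hLc, hLn, f, fun n => ?_, hf_surj, fun n => ?_, ?_, ?_⟩
  · refine (hp n).forall₂.2 fun x y => ?_
    rw [hf_dist]
    exact hd_le n x y
  · refine funext ((hp n).forall.2 fun x => ?_)
    rw [hfp]
    exact hfp (n + 1) x
  · intro Z _ _ _ h hh hcomp
    have hhp : ∀ n x, h n (p n x) = h 0 x := comp_transitionFromZero hcomp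
    have hh_le : ∀ x y, dist (h 0 x) (h 0 y) ≤ d x y := fun x y =>
      le_ciInf fun n => by
        rw [← hhp n x, ← hhp n y]
        exact hh n _ _
    let ν : L → Z := fun z => h 0 (Function.surjInv hπ z)
    have hν : ∀ x, ν (π x) = h 0 x := fun x => by
      refine dist_le_zero.1 ((hh_le _ _).trans ?_)
      rw [← hπd, Function.surjInv_eq hπ, dist_self]
    refine ⟨ν, ⟨?_, fun n => ?_⟩, ?_⟩
    · refine hπ.forall₂.2 fun x y => ?_
      rw [hν, hν, hπd]
      exact hh_le x y
    · refine funext ((hp n).forall.2 fun x => ?_)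
      rw [Function.comp_apply, hfp, hν, hhp]
    · rintro μ ⟨-, hμ⟩
      refine funext (hπ.forall.2 fun x => ?_)
      rw [hν, ← hfp 0 x]
      exact congrFun (hμ 0) x
  · have hunif : TendstoUniformly (fun n (q : X 0 × X 0) => dist (p n q.1) (p n q.2))
        (fun q => dist (π q.1) (π q.2)) atTop := by
      refine Antitone.tendstoUniformly_of_forall_tendsto (fun n => ?_)
        (fun _ _ hmn q => antitone_dist_transitionFromZero hg_ne q.1 q.2 hmn) (by fun_prop) fun q => ?_
      · have := continuous_transitionFromZero hg_ne n
        exact (this.comp continuous_fst).dist (this.comp continuous_snd)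
      · rw [hπd]
        exact hlim q.1 q.2
    refine Metric.tendsto_atTop'.2 fun ε hε => ?_
    obtain ⟨N, hN⟩ := eventually_atTop.1 (Metric.tendstoUniformly_iff.1 hunif ε hε)
    refine ⟨N, fun n hn => ?_⟩
    have hdist : ghDist (X n) L ≤ ε / 2 :=
      ghDist_le_of_surjective_distortion (f n) (hf_surj n) <| (hp n).forall₂.2 fun x y => by
        rw [hfp, hfp, abs_sub_comm, ← Real.dist_eq]
        exact (hN n hn.le (x, y)).le
    exact hdist.trans_lt (half_lt_self hε)
end

section
/- Let Σ be a nonempty directed partial order and ({X_σ}, {α_σ^τ}) a direct system in cmn over Σ in which every arrow α_σ^τ (σ ≤ τ) is surjective. Then the system has an inductive limit in cmn, and the arrows α_σ : X_σ → X of this limit are surjective. Moreover, the net σ ↦ toGHSpace X_σ converges along the atTop filter on Σ to toGHSpace X, so the limit object depends, up to isometry, only on the objects X_σ and not on the choice of the surjective arrows. -/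
open GromovHausdorff Filter Topology

namespace NonexpansiveSystem

variable {I : Type} [PartialOrder I] {X : I → Type} [∀ σ, MetricSpace (X σ)]

/-- The points of all the spaces of a direct system. -/
def Points (X : I → Type) : Type := Σ σ, X σ

/-- The limit distance of two points of a direct system: the infimum of the distances of
their images in the spaces further along the system. -/
noncomputable def limDist (α : ∀ σ τ : I, σ ≤ τ → X σ → X τ) (p q : Points X) : ℝ :=
  ⨅ ϱ : {ϱ : I // p.1 ≤ ϱ ∧ q.1 ≤ ϱ},
    dist (α p.1 ϱ.1 ϱ.2.1 p.2) (α q.1 ϱ.1 ϱ.2.2 q.2)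

variable {α : ∀ σ τ : I, σ ≤ τ → X σ → X τ}

theorem limDist_le (p q : Points X) {ϱ : I} (hp : p.1 ≤ ϱ) (hq : q.1 ≤ ϱ) :
    limDist α p q ≤ dist (α p.1 ϱ hp p.2) (α q.1 ϱ hq q.2) :=
  ciInf_le (f := fun ϱ : {ϱ : I // p.1 ≤ ϱ ∧ q.1 ≤ ϱ} =>
    dist (α p.1 ϱ.1 ϱ.2.1 p.2) (α q.1 ϱ.1 ϱ.2.2 q.2))
    ⟨0, by rintro _ ⟨ϱ, rfl⟩; exact dist_nonneg⟩ ⟨ϱ, hp, hq⟩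

theorem limDist_nonneg (p q : Points X) : 0 ≤ limDist α p q :=
  Real.iInf_nonneg fun _ => dist_nonneg

theorem dist_le_of_le
    (h_ne : ∀ (σ τ : I) (h : σ ≤ τ), IsNonexpansive (α σ τ h))
    (h_comp : ∀ (σ ϱ τ : I) (h₁ : σ ≤ ϱ) (h₂ : ϱ ≤ τ) (x : X σ),
      α ϱ τ h₂ (α σ ϱ h₁ x) = α σ τ (h₁.trans h₂) x)
    (p q : Points X) {ϱ τ : I} (hp : p.1 ≤ ϱ) (hq : q.1 ≤ ϱ) (h : ϱ ≤ τ) :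
    dist (α p.1 τ (hp.trans h) p.2) (α q.1 τ (hq.trans h) q.2) ≤
      dist (α p.1 ϱ hp p.2) (α q.1 ϱ hq q.2) := by
  rw [← h_comp _ _ _ hp h, ← h_comp _ _ _ hq h]
  exact h_ne ϱ τ h _ _

variable [IsDirected I (· ≤ ·)]

theorem exists_dist_lt (p q : Points X) {r : ℝ} (h : limDist α p q < r) :
    ∃ (ϱ : I) (hp : p.1 ≤ ϱ) (hq : q.1 ≤ ϱ),
      dist (α p.1 ϱ hp p.2) (α q.1 ϱ hq q.2) < r := by
  obtain ⟨ϱ₀, hp, hq⟩ := exists_ge_ge p.1 q.1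
  have : Nonempty {ϱ : I // p.1 ≤ ϱ ∧ q.1 ≤ ϱ} := ⟨⟨ϱ₀, hp, hq⟩⟩
  obtain ⟨ϱ, hϱ⟩ := exists_lt_of_ciInf_lt h
  exact ⟨ϱ.1, ϱ.2.1, ϱ.2.2, hϱ⟩

theorem le_limDist (p q : Points X) {r : ℝ}
    (h : ∀ (ϱ : I) (hp : p.1 ≤ ϱ) (hq : q.1 ≤ ϱ),
      r ≤ dist (α p.1 ϱ hp p.2) (α q.1 ϱ hq q.2)) : r ≤ limDist α p q := by
  by_contra! hlt
  obtain ⟨ϱ, hp, hq, hϱ⟩ := exists_dist_lt p q hlt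
  exact absurd hϱ (h ϱ hp hq).not_gt

/-- The limit distance as a pseudometric. -/
@[reducible]
noncomputable def pseudoMetricSpace
    (h_ne : ∀ (σ τ : I) (h : σ ≤ τ), IsNonexpansive (α σ τ h))
    (h_comp : ∀ (σ ϱ τ : I) (h₁ : σ ≤ ϱ) (h₂ : ϱ ≤ τ) (x : X σ),
      α ϱ τ h₂ (α σ ϱ h₁ x) = α σ τ (h₁.trans h₂) x) :
    PseudoMetricSpace (Points X) where
  dist := limDist α
  dist_self p := le_antisymm
    ((limDist_le p p le_rfl le_rfl).trans_eq (dist_self _)) (limDist_nonneg p p)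
  dist_comm p q := le_antisymm
    (le_limDist _ _ fun _ hq hp => (limDist_le p q hp hq).trans_eq (dist_comm _ _))
    (le_limDist _ _ fun _ hp hq => (limDist_le q p hq hp).trans_eq (dist_comm _ _))
  dist_triangle p q r := by
    refine le_of_forall_pos_lt_add fun ε hε => ?_
    obtain ⟨ϱ₁, hp, hq, h₁⟩ := exists_dist_lt (α := α) p q (lt_add_of_pos_right _ (half_pos hε))
    obtain ⟨ϱ₂, hq', hr, h₂⟩ := exists_dist_lt (α := α) q r (lt_add_of_pos_right _ (half_pos hε))
    obtain ⟨τ, hτ₁, hτ₂⟩ := exists_ge_ge ϱ₁ ϱ₂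
    have hpr := limDist_le (α := α) p r (hp.trans hτ₁) (hr.trans hτ₂)
    have htri := dist_triangle (α p.1 τ (hp.trans hτ₁) p.2) (α q.1 τ (hq.trans hτ₁) q.2)
      (α r.1 τ (hr.trans hτ₂) r.2)
    have hpq := dist_le_of_le h_ne h_comp p q hp hq hτ₁
    have hqr := dist_le_of_le h_ne h_comp q r hq' hr hτ₂
    linarith

/-- Along a direct system of compact spaces the distances converge uniformly to the limit
distance. -/
theorem exists_forall_dist_lt_limDist_add
    (h_ne : ∀ (σ τ : I) (h : σ ≤ τ), IsNonexpansive (α σ τ h))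
    (h_comp : ∀ (σ ϱ τ : I) (h₁ : σ ≤ ϱ) (h₂ : ϱ ≤ τ) (x : X σ),
      α ϱ τ h₂ (α σ ϱ h₁ x) = α σ τ (h₁.trans h₂) x)
    (σ : I) [CompactSpace (X σ)]
    (hcont : Continuous fun z : X σ × X σ => limDist α ⟨σ, z.1⟩ ⟨σ, z.2⟩)
    {ε : ℝ} (hε : 0 < ε) :
    ∃ (ϱ : I) (h : σ ≤ ϱ), ∀ x y : X σ,
      dist (α σ ϱ h x) (α σ ϱ h y) < limDist α ⟨σ, x⟩ ⟨σ, y⟩ + ε := by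
  let J := {ϱ : I // σ ≤ ϱ ∧ σ ≤ ϱ}
  let F : J → X σ × X σ → ℝ := fun ϱ z => dist (α σ ϱ.1 ϱ.2.1 z.1) (α σ ϱ.1 ϱ.2.1 z.2)
  have : Nonempty J := ⟨⟨σ, le_rfl, le_rfl⟩⟩
  have : IsDirected J (· ≤ ·) := ⟨fun a b => by
    obtain ⟨τ, ha, hb⟩ := exists_ge_ge a.1 b.1
    exact ⟨⟨τ, a.2.1.trans ha, a.2.1.trans ha⟩, ha, hb⟩⟩
  have hF : ∀ ϱ, Continuous (F ϱ) := fun ϱ => by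
    have h : Continuous (α σ ϱ.1 ϱ.2.1) :=
      (LipschitzWith.of_dist_le_mul (K := 1) fun x y => by
        simpa using h_ne σ ϱ.1 ϱ.2.1 x y).continuous
    fun_prop
  have hanti : ∀ z, Antitone fun ϱ => F ϱ z := fun z a b hab =>
    dist_le_of_le h_ne h_comp ⟨σ, z.1⟩ ⟨σ, z.2⟩ a.2.1 a.2.1 hab
  have hlim : ∀ z, Tendsto (fun ϱ => F ϱ z) atTop (𝓝 (limDist α ⟨σ, z.1⟩ ⟨σ, z.2⟩)) :=
    fun z => tendsto_atTop_ciInf (hanti z)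
      ⟨0, by rintro _ ⟨ϱ, rfl⟩; exact dist_nonneg⟩
  have hunif := Antitone.tendstoUniformly_of_forall_tendsto hF (fun a b hab z => hanti z hab) hcont hlim
  obtain ⟨ϱ, hϱ⟩ := (Metric.tendstoUniformly_iff.1 hunif ε hε).exists
  refine ⟨ϱ.1, ϱ.2.1, fun x y => ?_⟩
  have h := hϱ (x, y)
  rw [dist_comm, Real.dist_eq] at h
  have := (abs_lt.1 h).2
  simp only [F] at this
  linarith

end NonexpansiveSystem

open NonexpansiveSystem in
/-- **Theorem (inductive limits of direct systems in cmn).**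
Let `I` be a nonempty directed partial order and `({X σ}, {α σ τ})` a direct system of
nonempty compact metric spaces with surjective non-expansive arrows.  Then the system
has an inductive limit `L` in cmn, its arrows `f σ : X σ → L` are surjective, and the
net `σ ↦ toGHSpace (X σ)` converges along `atTop` to `toGHSpace L` (hence the limit
object depends only on the objects, up to isometry). -/
theorem inductive_limit_of_direct_system
    (I : Type) [PartialOrder I] [IsDirected I (· ≤ ·)] [Nonempty I]
    (X : I → Type) [∀ σ, MetricSpace (X σ)] [∀ σ, CompactSpace (X σ)] [∀ σ, Nonempty (X σ)]
    (α : ∀ σ τ : I, σ ≤ τ → X σ → X τ)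
    (h_ne : ∀ (σ τ : I) (h : σ ≤ τ), IsNonexpansive (α σ τ h))
    (h_id : ∀ (σ : I) (x : X σ), α σ σ le_rfl x = x)
    (h_comp : ∀ (σ ϱ τ : I) (h₁ : σ ≤ ϱ) (h₂ : ϱ ≤ τ) (x : X σ),
      α ϱ τ h₂ (α σ ϱ h₁ x) = α σ τ (h₁.trans h₂) x)
    (h_surj : ∀ (σ τ : I) (h : σ ≤ τ), Function.Surjective (α σ τ h)) :
    ∃ (L : Type) (_ : MetricSpace L) (_ : CompactSpace L) (_ : Nonempty L)
      (f : ∀ σ, X σ → L),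
      (∀ σ, IsNonexpansive (f σ)) ∧
      (∀ σ, Function.Surjective (f σ)) ∧
      (∀ (σ τ : I) (h : σ ≤ τ), (f τ) ∘ (α σ τ h) = f σ) ∧
      (∀ (Z : Type) (_ : MetricSpace Z) (_ : CompactSpace Z) (_ : Nonempty Z)
        (ξ : ∀ σ, X σ → Z),
        (∀ σ, IsNonexpansive (ξ σ)) →
        (∀ (σ τ : I) (h : σ ≤ τ), (ξ τ) ∘ (α σ τ h) = ξ σ) →
        ∃! ν : L → Z, IsNonexpansive ν ∧ ∀ σ, ν ∘ (f σ) = ξ σ) ∧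
      Tendsto (fun σ => toGHSpace (X σ)) atTop (𝓝 (toGHSpace L)) := by
  let _ : PseudoMetricSpace (Points X) := pseudoMetricSpace h_ne h_comp
  let f : ∀ σ, X σ → SeparationQuotient (Points X) :=
    fun σ x => SeparationQuotient.mk (⟨σ, x⟩ : Points X)
  have hdist : ∀ {σ τ : I} (x : X σ) (y : X τ),
      dist (f σ x) (f τ y) = limDist α ⟨σ, x⟩ ⟨τ, y⟩ := fun _ _ => rfl
  have hf_ne : ∀ σ, IsNonexpansive (f σ) := fun σ x y => by
    have h := limDist_le (α := α) ⟨σ, x⟩ ⟨σ, y⟩ (ϱ := σ) le_rfl le_rfl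
    simpa only [h_id] using (hdist x y).trans_le h
  have hf_eq : ∀ {σ τ ϱ : I} (hσ : σ ≤ ϱ) (hτ : τ ≤ ϱ) (x : X σ) (y : X τ),
      α σ ϱ hσ x = α τ ϱ hτ y → f σ x = f τ y := fun hσ hτ x y h => by
    refine dist_le_zero.1 ((limDist_le (α := α) ⟨_, x⟩ ⟨_, y⟩ hσ hτ).trans_eq ?_)
    simp only [h, dist_self]
  have hf_surj : ∀ σ, Function.Surjective (f σ) := fun σ l => by
    obtain ⟨⟨τ, y⟩, rfl⟩ := SeparationQuotient.surjective_mk l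
    obtain ⟨ϱ, hσ, hτ⟩ := exists_ge_ge σ τ
    obtain ⟨x, hx⟩ := h_surj σ ϱ hσ (α τ ϱ hτ y)
    exact ⟨x, hf_eq hσ hτ x y hx⟩
  have hf_comp : ∀ (σ τ : I) (h : σ ≤ τ), f τ ∘ α σ τ h = f σ := fun σ τ h =>
    funext fun x => hf_eq le_rfl h _ _ (h_id τ _)
  have hf_cont : ∀ σ, Continuous (f σ) := fun σ =>
    (LipschitzWith.of_dist_le_mul (K := 1) fun x y => by simpa using hf_ne σ x y).continuous
  obtain ⟨σ₀⟩ := ‹Nonempty I›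
  have hcompact : CompactSpace (SeparationQuotient (Points X)) :=
    (hf_surj σ₀).compactSpace (hf_cont σ₀)
  have hnonempty : Nonempty (SeparationQuotient (Points X)) := Nonempty.map (f σ₀) inferInstance
  refine ⟨SeparationQuotient (Points X), inferInstance, hcompact, hnonempty, f, hf_ne, hf_surj,
    hf_comp, ?_, ?_⟩
  · intro Z _ _ _ ξ hξ_ne hξ_comp
    have hξ : ∀ p q : Points X, dist (ξ p.1 p.2) (ξ q.1 q.2) ≤ limDist α p q := fun p q =>
      le_limDist p q fun ϱ hp hq => by
        rw [← hξ_comp _ _ hp, ← hξ_comp _ _ hq]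
        exact hξ_ne ϱ _ _
    refine ⟨SeparationQuotient.lift (fun p : Points X => ξ p.1 p.2) fun p q hpq =>
      dist_le_zero.1 ((hξ p q).trans_eq (Metric.inseparable_iff.1 hpq)), ⟨?_, ?_⟩, ?_⟩
    · intro a b
      obtain ⟨p, rfl⟩ := SeparationQuotient.surjective_mk a
      obtain ⟨q, rfl⟩ := SeparationQuotient.surjective_mk b
      exact hξ p q
    · exact fun σ => rfl
    · rintro ν ⟨-, hν⟩
      funext a
      obtain ⟨p, rfl⟩ := SeparationQuotient.surjective_mk a
      exact congrFun (hν p.1) p.2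
  · rw [Metric.tendsto_nhds]
    intro ε hε
    have hcont : Continuous fun z : X σ₀ × X σ₀ => limDist α ⟨σ₀, z.1⟩ ⟨σ₀, z.2⟩ :=
      ((hf_cont σ₀).comp continuous_fst).dist ((hf_cont σ₀).comp continuous_snd)
    obtain ⟨ϱ, hϱ, hlt⟩ := exists_forall_dist_lt_limDist_add h_ne h_comp σ₀ hcont hε
    filter_upwards [eventually_ge_atTop ϱ] with τ hτ
    have hle : ghDist (X τ) (SeparationQuotient (Points X)) ≤ 0 + ε / 2 + 0 := by
      refine ghDist_le_of_approx_subsets (s := Set.univ) (fun x => f τ x)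
        (fun x => ⟨x, trivial, (dist_self x).le⟩) (fun l => ?_) ?_
      · obtain ⟨x, rfl⟩ := hf_surj τ l
        exact ⟨⟨x, trivial⟩, (dist_self _).le⟩
      · rintro ⟨x, -⟩ ⟨y, -⟩
        obtain ⟨a, rfl⟩ := h_surj σ₀ τ (hϱ.trans hτ) x
        obtain ⟨b, rfl⟩ := h_surj σ₀ τ (hϱ.trans hτ) y
        have hne := hf_ne τ (α σ₀ τ (hϱ.trans hτ) a) (α σ₀ τ (hϱ.trans hτ) b)
        have hmono := dist_le_of_le h_ne h_comp ⟨σ₀, a⟩ ⟨σ₀, b⟩ hϱ hϱ hτ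
        have hab := hlt a b
        rw [← hdist, ← hf_comp σ₀ τ (hϱ.trans hτ)] at hab
        simp only [Function.comp_apply] at hab
        change |dist (α σ₀ τ _ a) (α σ₀ τ _ b) - dist (f τ _) (f τ _)| ≤ ε
        rw [abs_of_nonneg (sub_nonneg.2 hne)]
        linarith
    change ghDist (X τ) (SeparationQuotient (Points X)) < ε
    linarith
end

section
/- Let Σ be a nonempty directed partial order and ({X_σ}, {α_σ^τ}) a direct system in cmn over Σ in which every arrow α_σ^τ (σ ≤ τ) is surjective. Then the net σ ↦ toGHSpace X_σ converges in GHSpace: there exists p ∈ GHSpace such that (fun σ => toGHSpace X_σ) tends to p along the atTop filter on Σ. -/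
open GromovHausdorff Filter Topology

/-- A real function bounded below takes a value within `ε` of all smaller ones. -/
theorem exists_forall_lt_add_of_bddBelow {ι : Type*} [Nonempty ι] {f : ι → ℝ}
    (hf : BddBelow (Set.range f)) {ε : ℝ} (hε : 0 < ε) : ∃ i, ∀ j, f i < f j + ε := by
  obtain ⟨i, hi⟩ := exists_lt_of_ciInf_lt (lt_add_of_pos_right (⨅ i, f i) hε)
  exact ⟨i, fun j => hi.trans_le (by gcongr; exact ciInf_le hf j)⟩

/-- A direct system of nonempty compact metric spaces with surjective non-expansive arrows has,
for every `ε > 0`, a member whose Gromov–Hausdorff distance to all later ones is at most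
`5 * ε / 2`. -/
theorem exists_forall_dist_toGHSpace_le
    {I : Type} [PartialOrder I] [Nonempty I]
    {X : I → Type} [∀ σ, MetricSpace (X σ)] [∀ σ, CompactSpace (X σ)] [∀ σ, Nonempty (X σ)]
    {α : ∀ σ τ : I, σ ≤ τ → X σ → X τ}
    (h_ne : ∀ (σ τ : I) (h : σ ≤ τ), IsNonexpansive (α σ τ h))
    (h_comp : ∀ (σ ϱ τ : I) (h₁ : σ ≤ ϱ) (h₂ : ϱ ≤ τ) (x : X σ),
      α ϱ τ h₂ (α σ ϱ h₁ x) = α σ τ (h₁.trans h₂) x)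
    (h_surj : ∀ (σ τ : I) (h : σ ≤ τ), Function.Surjective (α σ τ h))
    {ε : ℝ} (hε : 0 < ε) :
    ∃ ρ, ∀ τ, ρ ≤ τ → dist (toGHSpace (X ρ)) (toGHSpace (X τ)) ≤ ε + ε / 2 + ε := by
  classical
  obtain ⟨σ⟩ := ‹Nonempty I›
  obtain ⟨t, -, htf, ht⟩ :=
    Metric.finite_approx_of_totallyBounded (isCompact_univ (X := X σ)).totallyBounded ε hε
  lift t to Finset (X σ) using htf
  have h_net : ∀ x : X σ, ∃ y ∈ t, dist x y ≤ ε := fun x => by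
    obtain ⟨y, hy, hxy⟩ := Set.mem_iUnion₂.1 (ht (Set.mem_univ x))
    exact ⟨y, hy, (Metric.mem_ball.1 hxy).le⟩
  have : Nonempty {τ // σ ≤ τ} := ⟨⟨σ, le_rfl⟩⟩
  let S : {τ // σ ≤ τ} → ℝ := fun τ =>
    ∑ p ∈ t ×ˢ t, dist (α σ τ τ.2 p.1) (α σ τ τ.2 p.2)
  have hS : BddBelow (Set.range S) :=
    ⟨0, by rintro _ ⟨τ, rfl⟩; exact Finset.sum_nonneg fun _ _ => dist_nonneg⟩
  obtain ⟨⟨ρ, hσρ⟩, hρ⟩ := exists_forall_lt_add_of_bddBelow hS hε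
  refine ⟨ρ, fun τ hρτ => ?_⟩
  have h_dense : ∀ (υ : I) (h : σ ≤ υ) (x : X υ), ∃ y ∈ t, dist x (α σ υ h y) ≤ ε := by
    intro υ h x
    obtain ⟨x, rfl⟩ := h_surj σ υ h x
    obtain ⟨y, hy, hxy⟩ := h_net x
    exact ⟨y, hy, (h_ne σ υ h x y).trans hxy⟩
  refine ghDist_le_of_approx_subsets (s := α σ ρ hσρ '' t) (fun x => α ρ τ hρτ x) ?_ ?_ ?_
  · intro x
    obtain ⟨y, hy, hxy⟩ := h_dense ρ hσρ x
    exact ⟨_, Set.mem_image_of_mem _ hy, hxy⟩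
  · intro x
    obtain ⟨y, hy, hxy⟩ := h_dense τ (hσρ.trans hρτ) x
    exact ⟨⟨_, Set.mem_image_of_mem _ hy⟩, by simpa only [h_comp] using hxy⟩
  · rintro ⟨_, x, hx, rfl⟩ ⟨_, y, hy, rfl⟩
    have h_le : ∀ p : X σ × X σ, dist (α σ τ (hσρ.trans hρτ) p.1) (α σ τ (hσρ.trans hρτ) p.2) ≤
        dist (α σ ρ hσρ p.1) (α σ ρ hσρ p.2) := fun p => by
      simpa only [h_comp] using h_ne ρ τ hρτ (α σ ρ hσρ p.1) (α σ ρ hσρ p.2)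
    have h_sum := hρ ⟨τ, hσρ.trans hρτ⟩
    have h_single := Finset.single_le_sum (fun p _ => sub_nonneg.2 (h_le p))
      (Finset.mk_mem_product hx hy)
    rw [Finset.sum_sub_distrib] at h_single
    simp only [Subtype.dist_eq, h_comp]
    rw [abs_of_nonneg (sub_nonneg.2 (h_le (x, y)))]
    simp only [S] at h_sum
    linarith

/-- **Corollary.** The net of objects of a direct system in cmn with surjective
non-expansive arrows converges in the Gromov–Hausdorff space. -/
theorem direct_system_net_converges_in_GHSpace
    (I : Type) [PartialOrder I] [IsDirected I (· ≤ ·)] [Nonempty I]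
    (X : I → Type) [∀ σ, MetricSpace (X σ)] [∀ σ, CompactSpace (X σ)] [∀ σ, Nonempty (X σ)]
    (α : ∀ σ τ : I, σ ≤ τ → X σ → X τ)
    (h_ne : ∀ (σ τ : I) (h : σ ≤ τ), IsNonexpansive (α σ τ h))
    (h_id : ∀ (σ : I) (x : X σ), α σ σ le_rfl x = x)
    (h_comp : ∀ (σ ϱ τ : I) (h₁ : σ ≤ ϱ) (h₂ : ϱ ≤ τ) (x : X σ),
      α ϱ τ h₂ (α σ ϱ h₁ x) = α σ τ (h₁.trans h₂) x)
    (h_surj : ∀ (σ τ : I) (h : σ ≤ τ), Function.Surjective (α σ τ h)) :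
    ∃ p : GHSpace, Tendsto (fun σ => toGHSpace (X σ)) atTop (𝓝 p) := by
  refine cauchy_map_iff_exists_tendsto.1 (Metric.cauchy_iff.2 ⟨inferInstance, fun ε hε => ?_⟩)
  obtain ⟨ρ, hρ⟩ := exists_forall_dist_toGHSpace_le h_ne h_comp h_surj
    (show 0 < ε / 6 by positivity)
  refine ⟨_, image_mem_map (Ici_mem_atTop ρ), ?_⟩
  rintro _ ⟨σ, hσ, rfl⟩ _ ⟨τ, hτ, rfl⟩
  linarith [hρ σ hσ, hρ τ hτ, dist_triangle_left (toGHSpace (X σ)) (toGHSpace (X τ))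
    (toGHSpace (X ρ))]
end

section
/- Let (X_n)_{n∈ℕ} be nonempty compact metric spaces forming a decreasing sequence with respect to ≼, i.e. for every n there exists a non-expansive surjection from X_n onto X_{n+1}. Then the sequence n ↦ toGHSpace X_n converges in GHSpace. -/
open GromovHausdorff Filter Topology

/-- If a common parametrization of two compact metric spaces distorts distances by at most `ε`,
then their Gromov–Hausdorff distance is at most `3 / 2 * ε`. -/
theorem dist_toGHSpace_le_of_surjective {Z X Y : Type*}
    [MetricSpace X] [CompactSpace X] [Nonempty X] [MetricSpace Y] [CompactSpace Y] [Nonempty Y]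
    {f : Z → X} {g : Z → Y} (hf : Function.Surjective f) (hg : Function.Surjective g) {ε : ℝ}
    (h : ∀ a b, |dist (f a) (f b) - dist (g a) (g b)| ≤ ε) :
    dist (toGHSpace X) (toGHSpace Y) ≤ 3 / 2 * ε := by
  have key : ghDist X Y ≤ 0 + ε / 2 + ε := by
    refine ghDist_le_of_approx_subsets (s := Set.univ)
      (fun x => g (Function.surjInv hf x)) (fun x => ⟨x, trivial, (dist_self x).le⟩) ?_ ?_
    · intro y
      obtain ⟨a, rfl⟩ := hg y
      refine ⟨⟨f a, trivial⟩, ?_⟩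
      simpa [Function.surjInv_eq hf] using h a (Function.surjInv hf (f a))
    · intro x y
      simpa [Function.surjInv_eq hf, Subtype.dist_eq] using
        h (Function.surjInv hf x) (Function.surjInv hf y)
  rw [ghDist] at key
  linarith

/-- A sequence of nonexpansive surjections of a compact metric space whose pulled-back distances
decrease has Gromov–Hausdorff convergent targets. -/
theorem exists_tendsto_toGHSpace_of_antitone_dist {Z : Type*} [PseudoMetricSpace Z]
    [CompactSpace Z] {X : ℕ → Type*} [∀ n, MetricSpace (X n)] [∀ n, CompactSpace (X n)]
    [∀ n, Nonempty (X n)] {g : ∀ n, Z → X n} (hg : ∀ n, LipschitzWith 1 (g n))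
    (hsurj : ∀ n, Function.Surjective (g n))
    (hanti : ∀ a b, Antitone fun n => dist (g n a) (g n b)) :
    ∃ p : GHSpace, Tendsto (fun n => toGHSpace (X n)) atTop (𝓝 p) := by
  let D : ℕ → Z × Z → ℝ := fun n z => dist (g n z.1) (g n z.2)
  have hD : Equicontinuous D := by
    refine (LipschitzWith.uniformEquicontinuous D 2 fun n => .of_dist_le_mul fun x y => ?_)
      |>.equicontinuous
    calc dist (D n x) (D n y)
        ≤ dist (g n x.1) (g n y.1) + dist (g n x.2) (g n y.2) := dist_dist_dist_le _ _ _ _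
      _ ≤ dist x.1 y.1 + dist x.2 y.2 := by
          gcongr <;> simpa using (hg n).dist_le_mul _ _
      _ ≤ dist x y + dist x y := by
          gcongr
          · exact le_max_left _ _
          · exact le_max_right _ _
      _ = (2 : NNReal) * dist x y := by push_cast; ring
  have hlim : Tendsto D atTop (𝓝 fun z => ⨅ n, D n z) :=
    tendsto_pi_nhds.2 fun z => tendsto_atTop_ciInf (hanti z.1 z.2)
      ⟨0, Set.forall_mem_range.2 fun _ => dist_nonneg⟩
  have hunif := UniformFun.tendsto_iff_tendstoUniformly.1
    ((hD.tendsto_uniformFun_iff_pi _ _).2 hlim)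
  refine cauchySeq_tendsto_of_complete (Metric.cauchySeq_iff.2 fun ε hε => ?_)
  obtain ⟨N, hN⟩ := eventually_atTop.1 (Metric.tendstoUniformly_iff.1 hunif (ε / 4) (by positivity))
  refine ⟨N, fun m hm n hn => ?_⟩
  have hmn := dist_toGHSpace_le_of_surjective (hsurj m) (hsurj n) (ε := ε / 4 + ε / 4)
    fun a b => (dist_triangle_left (D m (a, b)) (D n (a, b)) _).trans
      (add_le_add (hN m hm (a, b)).le (hN n hn (a, b)).le)
  linarith

/-- **Corollary.** A sequence of nonempty compact metric spaces which is decreasing with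
respect to `≼` (for every `n` there is a non-expansive surjection from `X n` onto
`X (n+1)`) converges in the Gromov–Hausdorff space. -/
theorem decreasing_sequence_converges_in_GHSpace
    (X : ℕ → Type) [∀ n, MetricSpace (X n)] [∀ n, CompactSpace (X n)] [∀ n, Nonempty (X n)]
    (hdec : ∀ n, ∃ f : X n → X (n + 1), IsNonexpansive f ∧ Function.Surjective f) :
    ∃ p : GHSpace, Tendsto (fun n => toGHSpace (X n)) atTop (𝓝 p) := by
  choose f hf hfsurj using hdec
  let g : ∀ n, X 0 → X n := fun n => Nat.rec id (fun n gn => f n ∘ gn) n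
  have hanti (a b : X 0) : Antitone fun n => dist (g n a) (g n b) :=
    antitone_nat_of_succ_le fun n => hf n (g n a) (g n b)
  refine exists_tendsto_toGHSpace_of_antitone_dist (g := g)
    (fun n => .of_dist_le_mul fun a b => ?_) (fun n => ?_) hanti
  · simpa [g] using hanti a b n.zero_le
  · induction n with
    | zero => exact Function.surjective_id
    | succ n ih => exact (hfsurj n).comp ih
end

section
/- Let Σ be a nonempty directed partial order and ({X^σ}, {α_τ^σ}) an inverse system in cmn over Σ in which every arrow α_τ^σ (σ ≤ τ) is surjective. Then the system has an inverse limit in cmn if and only if there exist a nonempty compact metric space Y and, for every σ ∈ Σ, a non-expansive surjection from Y onto X^σ. Furthermore, if (X, {α^σ}) is an inverse limit of the system, then every arrow α^σ : X → X^σ is surjective. -/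
open GromovHausdorff Filter Topology

/-- `(L, f)` is an inverse limit in cmn of the inverse system `({X σ}, {α τ σ})`
(where `α σ τ h : X τ → X σ` for `h : σ ≤ τ`). -/
def IsInverseLimit (I : Type) [PartialOrder I]
    (X : I → Type) [∀ σ, MetricSpace (X σ)]
    (α : ∀ σ τ : I, σ ≤ τ → X τ → X σ)
    (L : Type) [MetricSpace L] [CompactSpace L] [Nonempty L]
    (f : ∀ σ, L → X σ) : Prop :=
  (∀ σ, IsNonexpansive (f σ)) ∧
  (∀ (σ τ : I) (h : σ ≤ τ) (x : L), α σ τ h (f τ x) = f σ x) ∧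
  (∀ (Z : Type) (_ : MetricSpace Z) (_ : CompactSpace Z) (_ : Nonempty Z)
    (ξ : ∀ σ, Z → X σ),
    (∀ σ, IsNonexpansive (ξ σ)) →
    (∀ (σ τ : I) (h : σ ≤ τ) (z : Z), α σ τ h (ξ τ z) = ξ σ z) →
    ∃! ν : Z → L, IsNonexpansive ν ∧ ∀ (σ : I) (z : Z), f σ (ν z) = ξ σ z)

section Threads

variable {I : Type} [PartialOrder I] {X : I → Type}

/-- The compatible families of an inverse system. -/
def Threads (α : ∀ σ τ : I, σ ≤ τ → X τ → X σ) : Type :=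
  {x : ∀ σ, X σ // ∀ (σ τ : I) (h : σ ≤ τ), α σ τ h (x τ) = x σ}

variable [∀ σ, MetricSpace (X σ)] {α : ∀ σ τ : I, σ ≤ τ → X τ → X σ}

/-- Along an ultrafilter finer than `atTop`, every choice of points `z τ : X τ` has
projections converging to a compatible family. -/
theorem exists_thread_limit [∀ σ, CompactSpace (X σ)]
    (h_ne : ∀ (σ τ : I) (h : σ ≤ τ), IsNonexpansive (α σ τ h))
    (h_comp : ∀ (σ ϱ τ : I) (h₁ : σ ≤ ϱ) (h₂ : ϱ ≤ τ) (x : X τ),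
      α σ ϱ h₁ (α ϱ τ h₂ x) = α σ τ (h₁.trans h₂) x)
    (U : Ultrafilter I) (hU : (U : Filter I) ≤ atTop) (z : ∀ τ, X τ) :
    ∃ t : Threads α, ∀ (σ : I) (ε : ℝ), 0 < ε →
      ∀ᶠ τ in U, ∃ h : σ ≤ τ, dist (α σ τ h (z τ)) (t.1 σ) < ε := by
  classical
  have key : ∀ σ, ∃ x : X σ, ∀ ε : ℝ, 0 < ε →
      ∀ᶠ τ in U, ∃ h : σ ≤ τ, dist (α σ τ h (z τ)) x < ε := by
    intro σ
    let F : I → X σ := fun τ => if h : σ ≤ τ then α σ τ h (z τ) else z σ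
    obtain ⟨x, -, hx⟩ := isCompact_univ.ultrafilter_le_nhds (U.map F) (by simp)
    refine ⟨x, fun ε hε => ?_⟩
    have hF : ∀ᶠ τ in U, F τ ∈ Metric.ball x ε := hx (Metric.ball_mem_nhds x hε)
    filter_upwards [hF, hU (mem_atTop σ)] with τ hτ hστ
    have hστ : σ ≤ τ := hστ
    exact ⟨hστ, by simpa [F, hστ] using hτ⟩
  choose t ht using key
  refine ⟨⟨t, fun σ ϱ h => ?_⟩, ht⟩
  refine eq_of_forall_dist_le fun ε hε => ?_
  obtain ⟨τ, ⟨h₁, hd₁⟩, h₂, hd₂⟩ :=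
    ((ht σ (ε / 2) (half_pos hε)).and (ht ϱ (ε / 2) (half_pos hε))).exists
  have hne := h_ne σ ϱ h (α ϱ τ h₂ (z τ)) (t ϱ)
  rw [h_comp] at hne
  linarith [dist_triangle_left (α σ ϱ h (t ϱ)) (t σ) (α σ τ h₁ (z τ))]

/-- An inverse system of nonempty compact metric spaces with surjective arrows has a
compatible family through every point. -/
theorem exists_thread_eq [IsDirected I (· ≤ ·)] [Nonempty I] [∀ σ, CompactSpace (X σ)]
    [∀ σ, Nonempty (X σ)]
    (h_ne : ∀ (σ τ : I) (h : σ ≤ τ), IsNonexpansive (α σ τ h))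
    (h_comp : ∀ (σ ϱ τ : I) (h₁ : σ ≤ ϱ) (h₂ : ϱ ≤ τ) (x : X τ),
      α σ ϱ h₁ (α ϱ τ h₂ x) = α σ τ (h₁.trans h₂) x)
    (h_surj : ∀ (σ τ : I) (h : σ ≤ τ), Function.Surjective (α σ τ h))
    (σ : I) (x : X σ) : ∃ t : Threads α, t.1 σ = x := by
  have hz : ∀ τ, ∃ z : X τ, ∀ h : σ ≤ τ, α σ τ h z = x := by
    intro τ
    by_cases h : σ ≤ τ
    · exact (h_surj σ τ h x).imp fun _ hz _ => hz
    · exact ⟨Classical.arbitrary _, fun h' => absurd h' h⟩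
  choose z hz using hz
  obtain ⟨t, ht⟩ :=
    exists_thread_limit h_ne h_comp (Ultrafilter.of atTop) (Ultrafilter.of_le _) z
  refine ⟨t, eq_of_forall_dist_le fun ε hε => ?_⟩
  obtain ⟨τ, h, hd⟩ := (ht σ ε hε).exists
  rw [hz, dist_comm] at hd
  exact hd.le

/-- The supremum metric on the compatible families of a uniformly bounded inverse system. -/
noncomputable abbrev Threads.metricSpace [Nonempty I]
    (hb : ∀ x y : Threads α, BddAbove (Set.range fun σ => dist (x.1 σ) (y.1 σ))) :
    MetricSpace (Threads α) where
  dist x y := ⨆ σ, dist (x.1 σ) (y.1 σ)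
  dist_self x := by simp
  dist_comm x y := by simp only [dist_comm]
  dist_triangle x y z := ciSup_le fun σ => (dist_triangle _ (y.1 σ) _).trans
    (add_le_add (le_ciSup (hb x y) σ) (le_ciSup (hb y z) σ))
  eq_of_dist_eq_zero {x y} h := Subtype.ext <| funext fun σ =>
    dist_le_zero.1 ((le_ciSup (hb x y) σ).trans h.le)

/-- If one compact metric space has non-expansive surjections onto all objects of an inverse
system, then it has a surjection onto the compatible families that is non-expansive in each
coordinate. -/
theorem exists_surjective_threads [IsDirected I (· ≤ ·)] [Nonempty I]
    [∀ σ, CompactSpace (X σ)]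
    (h_ne : ∀ (σ τ : I) (h : σ ≤ τ), IsNonexpansive (α σ τ h))
    (h_comp : ∀ (σ ϱ τ : I) (h₁ : σ ≤ ϱ) (h₂ : ϱ ≤ τ) (x : X τ),
      α σ ϱ h₁ (α ϱ τ h₂ x) = α σ τ (h₁.trans h₂) x)
    {Y : Type} [MetricSpace Y] [CompactSpace Y] (g : ∀ σ, Y → X σ)
    (hg : ∀ σ, IsNonexpansive (g σ)) (hgs : ∀ σ, Function.Surjective (g σ)) :
    ∃ p : Y → Threads α, Function.Surjective p ∧
      ∀ σ, IsNonexpansive fun y => (p y).1 σ := by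
  let U : Ultrafilter I := Ultrafilter.of atTop
  choose p hp using fun y =>
    exists_thread_limit h_ne h_comp U (Ultrafilter.of_le _) fun τ => g τ y
  refine ⟨p, fun t => ?_, fun σ y y' => le_of_forall_pos_le_add fun ε hε => ?_⟩
  · choose w hw using fun τ => hgs τ (t.1 τ)
    obtain ⟨y, -, hy⟩ := isCompact_univ.ultrafilter_le_nhds (U.map w) (by simp)
    refine ⟨y, Subtype.ext <| funext fun σ => eq_of_forall_dist_le fun ε hε => ?_⟩
    have hwy : ∀ᶠ τ in U, w τ ∈ Metric.ball y (ε / 2) :=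
      hy (Metric.ball_mem_nhds y (half_pos hε))
    obtain ⟨τ, ⟨h, hd⟩, hτ⟩ := ((hp y σ (ε / 2) (half_pos hε)).and hwy).exists
    rw [Metric.mem_ball, dist_comm] at hτ
    have hle := (h_ne σ τ h (g τ y) (g τ (w τ))).trans (hg τ y (w τ))
    rw [hw, t.2] at hle
    linarith [dist_triangle_left ((p y).1 σ) (t.1 σ) (α σ τ h (g τ y))]
  · obtain ⟨τ, ⟨h, hd⟩, _, hd'⟩ :=
      ((hp y σ (ε / 2) (half_pos hε)).and (hp y' σ (ε / 2) (half_pos hε))).exists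
    have hle := (h_ne σ τ h (g τ y) (g τ y')).trans (hg τ y y')
    have h₁ := dist_triangle_left ((p y).1 σ) ((p y').1 σ) (α σ τ h (g τ y))
    have h₂ := dist_triangle (α σ τ h (g τ y)) (α σ τ h (g τ y')) ((p y').1 σ)
    linarith

/-- An inverse system dominated by a single compact metric space has an inverse limit. -/
theorem exists_isInverseLimit [IsDirected I (· ≤ ·)] [Nonempty I]
    [∀ σ, CompactSpace (X σ)]
    (h_ne : ∀ (σ τ : I) (h : σ ≤ τ), IsNonexpansive (α σ τ h))
    (h_comp : ∀ (σ ϱ τ : I) (h₁ : σ ≤ ϱ) (h₂ : ϱ ≤ τ) (x : X τ),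
      α σ ϱ h₁ (α ϱ τ h₂ x) = α σ τ (h₁.trans h₂) x)
    {Y : Type} [MetricSpace Y] [CompactSpace Y] [Nonempty Y] (g : ∀ σ, Y → X σ)
    (hg : ∀ σ, IsNonexpansive (g σ)) (hgs : ∀ σ, Function.Surjective (g σ)) :
    ∃ (L : Type) (_ : MetricSpace L) (_ : CompactSpace L) (_ : Nonempty L)
      (f : ∀ σ, L → X σ), IsInverseLimit I X α L f := by
  obtain ⟨p, hps, hp⟩ := exists_surjective_threads h_ne h_comp g hg hgs
  have hb : ∀ x y : Threads α, BddAbove (Set.range fun σ => dist (x.1 σ) (y.1 σ)) := by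
    intro x y
    obtain ⟨a, rfl⟩ := hps x
    obtain ⟨b, rfl⟩ := hps y
    exact ⟨dist a b, Set.forall_mem_range.2 fun σ => hp σ a b⟩
  let _ : MetricSpace (Threads α) := Threads.metricSpace hb
  have hpc : Continuous p :=
    (LipschitzWith.of_dist_le_mul (K := 1) fun a b => by
      rw [NNReal.coe_one, one_mul]
      exact ciSup_le fun σ => hp σ a b).continuous
  have hL : CompactSpace (Threads α) := hps.compactSpace hpc
  refine ⟨Threads α, inferInstance, hL, Nonempty.map p inferInstance, fun σ t => t.1 σ,
    fun σ x y => le_ciSup (hb x y) σ, fun σ τ h x => x.2 σ τ h,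
    fun Z _ _ _ ξ hξ hξα => ?_⟩
  refine ⟨fun z => ⟨fun σ => ξ σ z, fun σ τ h => hξα σ τ h z⟩,
    ⟨fun a b => ciSup_le fun σ => hξ σ a b, fun _ _ => rfl⟩, fun ν hν => ?_⟩
  exact funext fun z => Subtype.ext <| funext fun σ => hν.2 σ z

/-- The arrows of an inverse limit of a system with surjective arrows are surjective. -/
theorem IsInverseLimit.surjective [IsDirected I (· ≤ ·)] [Nonempty I]
    [∀ σ, CompactSpace (X σ)] [∀ σ, Nonempty (X σ)]
    (h_ne : ∀ (σ τ : I) (h : σ ≤ τ), IsNonexpansive (α σ τ h))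
    (h_comp : ∀ (σ ϱ τ : I) (h₁ : σ ≤ ϱ) (h₂ : ϱ ≤ τ) (x : X τ),
      α σ ϱ h₁ (α ϱ τ h₂ x) = α σ τ (h₁.trans h₂) x)
    (h_surj : ∀ (σ τ : I) (h : σ ≤ τ), Function.Surjective (α σ τ h))
    {L : Type} [MetricSpace L] [CompactSpace L] [Nonempty L] {f : ∀ σ, L → X σ}
    (hf : IsInverseLimit I X α L f) (σ : I) : Function.Surjective (f σ) := by
  intro x
  obtain ⟨t, rfl⟩ := exists_thread_eq h_ne h_comp h_surj σ x
  obtain ⟨ν, ⟨-, hν⟩, -⟩ := hf.2.2 PUnit inferInstance inferInstance inferInstance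
    (fun τ _ => t.1 τ) (fun τ a b => by simp) (fun σ τ h _ => t.2 σ τ h)
  exact ⟨ν PUnit.unit, hν σ PUnit.unit⟩

end Threads

/-- **Theorem (inverse limits in cmn).**
An inverse system in cmn with surjective non-expansive arrows has an inverse limit
iff its family of objects admits a common non-expansive surjective image, i.e. there
is a nonempty compact metric space `Y` together with a non-expansive surjection from
`Y` onto every `X σ`.  Furthermore the arrows of any inverse limit are surjective. -/
theorem inverse_limit_iff_bounded_and_arrows_surjective
    (I : Type) [PartialOrder I] [IsDirected I (· ≤ ·)] [Nonempty I]
    (X : I → Type) [∀ σ, MetricSpace (X σ)] [∀ σ, CompactSpace (X σ)] [∀ σ, Nonempty (X σ)]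
    (α : ∀ σ τ : I, σ ≤ τ → X τ → X σ)
    (h_ne : ∀ (σ τ : I) (h : σ ≤ τ), IsNonexpansive (α σ τ h))
    (h_id : ∀ (σ : I) (x : X σ), α σ σ le_rfl x = x)
    (h_comp : ∀ (σ ϱ τ : I) (h₁ : σ ≤ ϱ) (h₂ : ϱ ≤ τ) (x : X τ),
      α σ ϱ h₁ (α ϱ τ h₂ x) = α σ τ (h₁.trans h₂) x)
    (h_surj : ∀ (σ τ : I) (h : σ ≤ τ), Function.Surjective (α σ τ h)) :
    ((∃ (L : Type) (_ : MetricSpace L) (_ : CompactSpace L) (_ : Nonempty L)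
        (f : ∀ σ, L → X σ), IsInverseLimit I X α L f) ↔
      (∃ (Y : Type) (_ : MetricSpace Y) (_ : CompactSpace Y) (_ : Nonempty Y),
        ∀ σ, ∃ g : Y → X σ, IsNonexpansive g ∧ Function.Surjective g)) ∧
    (∀ (L : Type) (_ : MetricSpace L) (_ : CompactSpace L) (_ : Nonempty L)
      (f : ∀ σ, L → X σ), IsInverseLimit I X α L f → ∀ σ, Function.Surjective (f σ)) := by
  have hs : ∀ (L : Type) (_ : MetricSpace L) (_ : CompactSpace L) (_ : Nonempty L)
      (f : ∀ σ, L → X σ), IsInverseLimit I X α L f → ∀ σ, Function.Surjective (f σ) :=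
    fun _ _ _ _ _ hf => hf.surjective h_ne h_comp h_surj
  refine ⟨⟨?_, ?_⟩, hs⟩
  · rintro ⟨L, _, _, _, f, hf⟩
    exact ⟨L, inferInstance, inferInstance, inferInstance,
      fun σ => ⟨f σ, hf.1 σ, hs L _ _ _ f hf σ⟩⟩
  · rintro ⟨Y, _, _, _, hY⟩
    choose g hg hgs using hY
    exact exists_isInverseLimit h_ne h_comp g hg hgs
end

section
/- Let (X_n)_{n∈ℕ} be nonempty compact metric spaces forming an increasing sequence with respect to ≼ (for every n there exists a non-expansive surjection from X_{n+1} onto X_n) which is bounded from above with respect to ≼ (there exists a nonempty compact metric space Y such that for every n there is a non-expansive surjection from Y onto X_n). Then the sequence n ↦ toGHSpace X_n converges in GHSpace. -/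
open GromovHausdorff Filter Topology

theorem IsNonexpansive.lipschitzWith {X Y : Type} [MetricSpace X] [MetricSpace Y] {f : X → Y}
    (hf : IsNonexpansive f) : LipschitzWith 1 f :=
  LipschitzWith.mk_one hf

theorem IsNonexpansive.comp {X Y Z : Type} [MetricSpace X] [MetricSpace Y] [MetricSpace Z]
    {g : Y → Z} {f : X → Y} (hg : IsNonexpansive g) (hf : IsNonexpansive f) :
    IsNonexpansive (g ∘ f) :=
  fun a b => (hg _ _).trans (hf a b)

/-- Two compact spaces that are images of a common space, with induced distances differing by at
most `ε`, are at Gromov–Hausdorff distance at most `3 * ε / 2`. -/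
theorem dist_toGHSpace_le_of_surjective_s7 {Y A B : Type} [MetricSpace A] [CompactSpace A]
    [Nonempty A] [MetricSpace B] [CompactSpace B] [Nonempty B] {P : Y → A} {Q : Y → B}
    (hP : Function.Surjective P) (hQ : Function.Surjective Q) {ε : ℝ}
    (h : ∀ y z, |dist (P y) (P z) - dist (Q y) (Q z)| ≤ ε) :
    dist (toGHSpace A) (toGHSpace B) ≤ 3 * ε / 2 := by
  have key := ghDist_le_of_approx_subsets (s := (Set.univ : Set A))
    (fun a => Q (Function.surjInv hP a)) (ε₁ := 0) (ε₂ := ε) (ε₃ := ε)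
    (fun a => ⟨a, Set.mem_univ a, (dist_self a).le⟩)
    (fun b => by
      obtain ⟨y, rfl⟩ := hQ b
      refine ⟨⟨P y, Set.mem_univ _⟩, ?_⟩
      simpa [Function.surjInv_eq hP (P y)] using h y (Function.surjInv hP (P y)))
    (fun a b => by
      rw [Subtype.dist_eq]
      simpa [Function.surjInv_eq] using h (Function.surjInv hP a) (Function.surjInv hP b))
  rw [ghDist] at key
  linarith

/-- If a sequence of compact spaces consists of images of a fixed compact space under compatible
non-expansive maps, then it is Cauchy in the Gromov–Hausdorff space. -/
theorem cauchySeq_toGHSpace_of_compatible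
    {X : ℕ → Type} [∀ n, MetricSpace (X n)] [∀ n, CompactSpace (X n)] [∀ n, Nonempty (X n)]
    {Y : Type} [MetricSpace Y] [CompactSpace Y]
    {f : ∀ n, X (n + 1) → X n} (hf : ∀ n, IsNonexpansive (f n))
    {g : ∀ n, Y → X n} (hg : ∀ n, IsNonexpansive (g n)) (hs : ∀ n, Function.Surjective (g n))
    (hfg : ∀ n, f n ∘ g (n + 1) = g n) :
    CauchySeq fun n => toGHSpace (X n) := by
  let d : ℕ → Y × Y → ℝ := fun n p => dist (g n p.1) (g n p.2)
  have hmono : Monotone d := monotone_nat_of_le_succ fun n p => by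
    change dist (g n p.1) (g n p.2) ≤ dist (g (n + 1) p.1) (g (n + 1) p.2)
    rw [← hfg n]
    exact hf n _ _
  have hbdd (p : Y × Y) : BddAbove (Set.range (d · p)) :=
    ⟨dist p.1 p.2, Set.forall_mem_range.2 fun n => hg n p.1 p.2⟩
  have hlim (p : Y × Y) : Tendsto (d · p) atTop (𝓝 (⨆ n, d n p)) :=
    tendsto_atTop_ciSup (fun _ _ h => hmono h p) (hbdd p)
  have hlip (n : ℕ) : LipschitzWith 2 (d n) :=
    LipschitzWith.of_dist_le_mul fun p q => by
      refine (dist_dist_dist_le _ _ _ _).trans ?_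
      have h₁ : dist p.1 q.1 ≤ dist p q := le_max_left _ _
      have h₂ : dist p.2 q.2 ≤ dist p q := le_max_right _ _
      have := hg n p.1 q.1
      have := hg n p.2 q.2
      push_cast
      linarith
  have hlip' : LipschitzWith 2 fun p => ⨆ n, d n p :=
    LipschitzWith.of_dist_le_mul fun p q =>
      le_of_tendsto ((hlim p).dist (hlim q)) (.of_forall fun n => (hlip n).dist_le_mul p q)
  have hunif := Monotone.tendstoUniformly_of_forall_tendsto (fun n => (hlip n).continuous) hmono
    hlip'.continuous hlim
  rw [Metric.tendstoUniformly_iff] at hunif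
  refine Metric.cauchySeq_iff.2 fun ε hε => ?_
  obtain ⟨N, hN⟩ := eventually_atTop.1 (hunif (ε / 4) (by positivity))
  refine ⟨N, fun m hm n hn => ?_⟩
  refine (dist_toGHSpace_le_of_surjective_s7 (hs m) (hs n) (ε := ε / 2) fun y z => ?_).trans_lt
    (by linarith)
  have h₁ := hN m hm (y, z)
  have h₂ := hN n hn (y, z)
  have h₃ := dist_triangle_left (d m (y, z)) (d n (y, z)) (⨆ k, d k (y, z))
  rw [Real.dist_eq (d m (y, z))] at h₃
  linarith

/-- Given non-expansive surjections along a tower and from `Y` onto each level, the maps from `Y`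
can be chosen compatible with the tower below any level `k`. -/
theorem exists_compatible_below
    {X : ℕ → Type} [∀ n, MetricSpace (X n)] {Y : Type} [MetricSpace Y]
    {f : ∀ n, X (n + 1) → X n} (hf : ∀ n, IsNonexpansive (f n) ∧ Function.Surjective (f n))
    (hbdd : ∀ n, ∃ g : Y → X n, IsNonexpansive g ∧ Function.Surjective g) (k : ℕ) (h : Y → X k)
    (hh : IsNonexpansive h ∧ Function.Surjective h) :
    ∃ g : ∀ n, Y → X n, (∀ n, IsNonexpansive (g n) ∧ Function.Surjective (g n)) ∧
      (∀ n < k, f n ∘ g (n + 1) = g n) ∧ g k = h := by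
  have update_spec {k : ℕ} {h : Y → X k} (hh : IsNonexpansive h ∧ Function.Surjective h)
      {g : ∀ n, Y → X n} (hg : ∀ n, IsNonexpansive (g n) ∧ Function.Surjective (g n)) (n : ℕ) :
      IsNonexpansive (Function.update g k h n) ∧
        Function.Surjective (Function.update g k h n) := by
    rcases eq_or_ne n k with rfl | hn
    · simpa using hh
    · simpa [hn] using hg n
  induction k with
  | zero =>
    choose g hg using hbdd
    exact ⟨Function.update g 0 h, update_spec hh hg, by simp, by simp⟩
  | succ k ih =>
    obtain ⟨g, hg, hfg, hk⟩ := ih (f k ∘ h) ⟨(hf k).1.comp hh.1, (hf k).2.comp hh.2⟩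
    refine ⟨Function.update g (k + 1) h, update_spec hh hg, fun n hn => ?_, by simp⟩
    rcases Nat.lt_succ_iff_lt_or_eq.1 hn with hn | rfl
    · rw [Function.update_of_ne (by omega), Function.update_of_ne (by omega), hfg n hn]
    · rw [Function.update_self, Function.update_of_ne (by omega), hk]

/-- A pointwise limit of non-expansive surjections from a compact space is surjective. -/
theorem surjective_of_tendsto_of_isNonexpansive {A Y : Type} [MetricSpace A] [MetricSpace Y]
    [CompactSpace Y] {ι : Type} (U : Ultrafilter ι) {φ : ι → Y → A}
    (hφ : ∀ i, IsNonexpansive (φ i)) (hs : ∀ i, Function.Surjective (φ i)) {ψ : Y → A}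
    (hψ : ∀ y, Tendsto (φ · y) U (𝓝 (ψ y))) : Function.Surjective ψ := by
  intro x
  choose y hy using fun i => hs i x
  have hlim : Tendsto y U (𝓝 (U.map y).lim) := (U.map y).le_nhds_lim
  refine ⟨(U.map y).lim, tendsto_nhds_unique (hψ _) ?_⟩
  refine tendsto_iff_dist_tendsto_zero.2 <|
    squeeze_zero (fun _ => dist_nonneg) (fun i => ?_) (tendsto_iff_dist_tendsto_zero.1 hlim)
  conv_lhs => rw [← hy i]
  rw [dist_comm (y i)]
  exact hφ i _ _

/-- Given non-expansive surjections along a tower of compact spaces and from a compact space `Y`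
onto each level, the maps from `Y` can be chosen compatible with the tower. -/
theorem exists_compatible
    {X : ℕ → Type} [∀ n, MetricSpace (X n)] [∀ n, CompactSpace (X n)]
    {Y : Type} [MetricSpace Y] [CompactSpace Y]
    {f : ∀ n, X (n + 1) → X n} (hf : ∀ n, IsNonexpansive (f n) ∧ Function.Surjective (f n))
    (hbdd : ∀ n, ∃ g : Y → X n, IsNonexpansive g ∧ Function.Surjective g) :
    ∃ g : ∀ n, Y → X n, (∀ n, IsNonexpansive (g n) ∧ Function.Surjective (g n)) ∧
      ∀ n, f n ∘ g (n + 1) = g n := by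
  choose h hh using hbdd
  choose φ hφ hfφ _ using fun k =>
    exists_compatible_below hf (fun n => ⟨h n, hh n⟩) k (h k) (hh k)
  let U : Ultrafilter ℕ := hyperfilter ℕ
  let g (n : ℕ) (y : Y) : X n := (U.map fun k => φ k n y).lim
  have hlim (n : ℕ) (y : Y) : Tendsto (fun k => φ k n y) U (𝓝 (g n y)) :=
    (U.map fun k => φ k n y).le_nhds_lim
  refine ⟨g, fun n => ⟨fun y z => ?_, ?_⟩, fun n => funext fun y => ?_⟩
  · exact le_of_tendsto ((hlim n y).dist (hlim n z)) (.of_forall fun k => (hφ k n).1 y z)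
  · exact surjective_of_tendsto_of_isNonexpansive U (fun k => (hφ k n).1)
      (fun k => (hφ k n).2) (hlim n)
  · have hcomp := ((hf n).1.lipschitzWith.continuous.tendsto _).comp (hlim (n + 1) y)
    refine tendsto_nhds_unique (hcomp.congr' ?_) (hlim n y)
    filter_upwards [Nat.hyperfilter_le_atTop (eventually_gt_atTop n)] with k hnk
    exact congrFun (hfφ k n hnk) y

/-- **Corollary.** A sequence of nonempty compact metric spaces which is increasing with
respect to `≼` (for every `n` there is a non-expansive surjection from `X (n+1)` onto
`X n`) and bounded from above with respect to `≼` converges in the Gromov–Hausdorff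
space. -/
theorem increasing_bounded_sequence_converges_in_GHSpace
    (X : ℕ → Type) [∀ n, MetricSpace (X n)] [∀ n, CompactSpace (X n)] [∀ n, Nonempty (X n)]
    (hinc : ∀ n, ∃ f : X (n + 1) → X n, IsNonexpansive f ∧ Function.Surjective f)
    (Y : Type) [MetricSpace Y] [CompactSpace Y] [Nonempty Y]
    (hbdd : ∀ n, ∃ g : Y → X n, IsNonexpansive g ∧ Function.Surjective g) :
    ∃ p : GHSpace, Tendsto (fun n => toGHSpace (X n)) atTop (𝓝 p) := by
  choose f hf using hinc
  obtain ⟨g, hg, hfg⟩ := exists_compatible hf hbdd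
  exact cauchySeq_tendsto_of_complete <| cauchySeq_toGHSpace_of_compatible
    (fun n => (hf n).1) (fun n => (hg n).1) (fun n => (hg n).2) hfg
end

section
/- Let (X_n)_{n∈ℕ} be nonempty compact metric spaces which form a monotone sequence with respect to ≼ (either X_{n+1} ≼ X_n for all n, or X_n ≼ X_{n+1} for all n) and which is bounded with respect to ≼ (there exists a nonempty compact metric space Y with X_n ≼ Y for all n). Then the sequence n ↦ toGHSpace X_n converges in GHSpace. -/
open GromovHausdorff Filter Topology

/-- `X ≼ Y`: there is a non-expansive surjection from `Y` onto `X`. -/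
def DomOrder (X Y : Type) [MetricSpace X] [MetricSpace Y] : Prop :=
  ∃ f : Y → X, IsNonexpansive f ∧ Function.Surjective f

open Metric

/-- Finite families of points with almost equal mutual distances which are `ε`-dense control the
Gromov–Hausdorff distance. -/
theorem ghDist_le_of_approx_nets {A B ι : Type} [MetricSpace A] [CompactSpace A] [Nonempty A]
    [MetricSpace B] [CompactSpace B] [Nonempty B] {ε : ℝ} (p : ι → A) (q : ι → B)
    (hp : ∀ x, ∃ i, dist x (p i) ≤ ε) (hq : ∀ y, ∃ i, dist y (q i) ≤ ε)
    (H : ∀ i j, |dist (p i) (p j) - dist (q i) (q j)| ≤ ε) :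
    ghDist A B ≤ 7 / 2 * ε := by
  choose idx hidx using fun x : Set.range p => x.2
  have key := ghDist_le_of_approx_subsets (s := Set.range p) (fun x => q (idx x))
    (ε₁ := ε) (ε₂ := ε) (ε₃ := 2 * ε) ?_ ?_ ?_
  · linarith
  · intro x
    obtain ⟨i, hi⟩ := hp x
    exact ⟨p i, ⟨i, rfl⟩, hi⟩
  · intro y
    obtain ⟨i, hi⟩ := hq y
    refine ⟨⟨p i, i, rfl⟩, ?_⟩
    have h := H i (idx ⟨p i, i, rfl⟩)
    rw [hidx, dist_self, zero_sub, abs_neg, abs_of_nonneg dist_nonneg] at h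
    linarith [dist_triangle y (q i) (q (idx ⟨p i, i, rfl⟩))]
  · intro x y
    simpa only [hidx, Subtype.dist_eq] using H (idx x) (idx y)

/-- A sequence of compact spaces converges in the Gromov–Hausdorff space if for every `ε > 0` its
tails admit finite `ε`-nets indexed by a common set with Cauchy mutual distances. -/
theorem exists_tendsto_toGHSpace_of_cauchySeq_nets
    (X : ℕ → Type) [∀ n, MetricSpace (X n)] [∀ n, CompactSpace (X n)] [∀ n, Nonempty (X n)]
    (h : ∀ ε > 0, ∃ (n₀ k : ℕ) (p : ∀ n, Fin k → X (n₀ + n)),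
      (∀ n x, ∃ i, dist x (p n i) ≤ ε) ∧ ∀ i j, CauchySeq fun n => dist (p n i) (p n j)) :
    ∃ p : GHSpace, Tendsto (fun n => toGHSpace (X n)) atTop (𝓝 p) := by
  apply cauchySeq_tendsto_of_complete
  rw [Metric.cauchySeq_iff']
  intro ε hε
  obtain ⟨n₀, k, p, hp, hc⟩ := h (ε / 4) (by positivity)
  have hev : ∀ᶠ mn : ℕ × ℕ in atTop ×ˢ atTop, ∀ i j,
      dist (dist (p mn.1 i) (p mn.1 j)) (dist (p mn.2 i) (p mn.2 j)) < ε / 4 := by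
    refine eventually_all.2 fun i => eventually_all.2 fun j => ?_
    have := Metric.cauchySeq_iff.1 (hc i j) (ε / 4) (by positivity)
    obtain ⟨N, hN⟩ := this
    filter_upwards [(eventually_ge_atTop N).prod_mk (eventually_ge_atTop N)] with mn hmn
    exact hN _ hmn.1 _ hmn.2
  rw [prod_atTop_atTop_eq] at hev
  obtain ⟨⟨a, b⟩, hab⟩ := eventually_atTop.1 hev
  refine ⟨n₀ + max a b, fun n hn => ?_⟩
  obtain ⟨m, rfl⟩ := Nat.exists_eq_add_of_le (le_trans (Nat.le_add_right _ _) hn)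
  have hm : max a b ≤ m := by omega
  have := ghDist_le_of_approx_nets (p m) (p (max a b)) (hp m) (hp _) fun i j =>
    (hab (m, max a b) ⟨(le_max_left _ _).trans hm, le_max_right _ _⟩ i j).le
  change ghDist _ _ < ε
  linarith

/-- The cardinality of `ε`-separated families in a compact space is bounded. -/
theorem exists_card_separated_le (Y : Type) [MetricSpace Y] [CompactSpace Y] {ε : ℝ}
    (hε : 0 < ε) :
    ∃ K : ℕ, ∀ (k : ℕ) (p : Fin k → Y), (∀ i j, i ≠ j → ε ≤ dist (p i) (p j)) → k ≤ K := by
  obtain ⟨t, -, ht, hcov⟩ :=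
    finite_cover_balls_of_compact (isCompact_univ (X := Y)) (half_pos hε)
  refine ⟨ht.toFinset.card, fun k p hp => ?_⟩
  have hex : ∀ i, ∃ y ∈ t, dist (p i) y < ε / 2 := fun i => by
    simpa using hcov (Set.mem_univ (p i))
  choose c hct hc using hex
  have hinj : Function.Injective c := by
    intro i j hij
    by_contra hne
    have h := hc j
    rw [← hij] at h
    linarith [hp i j hne, hc i, dist_triangle_right (p i) (p j) (c i)]
  simpa using Finset.card_le_card_of_injOn (s := Finset.univ) (t := ht.toFinset) c
    (fun i _ => by simpa using hct i) hinj.injOn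

/-- A `≼`-decreasing sequence of nonempty compact metric spaces converges. -/
theorem exists_tendsto_toGHSpace_of_antitone
    (X : ℕ → Type) [∀ n, MetricSpace (X n)] [∀ n, CompactSpace (X n)] [∀ n, Nonempty (X n)]
    (hX : ∀ n, DomOrder (X (n + 1)) (X n)) :
    ∃ p : GHSpace, Tendsto (fun n => toGHSpace (X n)) atTop (𝓝 p) := by
  choose f hf hsurj using hX
  refine exists_tendsto_toGHSpace_of_cauchySeq_nets X fun ε hε => ?_
  obtain ⟨t, -, ht, hcov⟩ :=
    finite_cover_balls_of_compact (isCompact_univ (X := X 0)) hε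
  obtain ⟨k, c, rfl⟩ : ∃ (k : ℕ) (c : Fin k → X 0), Set.range c = t := by
    have := ht.to_subtype
    obtain ⟨k, ⟨e⟩⟩ := Finite.exists_equiv_fin t
    exact ⟨k, fun i => e.symm i, by
      rw [Set.range_comp' Subtype.val e.symm, e.symm.range_eq_univ]; simp⟩
  suffices h : ∃ p : ∀ n, Fin k → X n,
      (∀ n x, ∃ i, dist x (p n i) ≤ ε) ∧ ∀ i j, CauchySeq fun n => dist (p n i) (p n j) by
    obtain ⟨p, hp, hc⟩ := h
    exact ⟨0, k, fun n => p (0 + n), fun n => hp (0 + n), fun i j =>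
      (hc i j).comp_tendsto (tendsto_atTop_mono (fun n => (zero_add n).ge) tendsto_id)⟩
  let p : ∀ n, Fin k → X n := fun n => Nat.rec c (fun n q i => f n (q i)) n
  refine ⟨p, fun n => ?_, fun i j => ?_⟩
  · induction n with
    | zero =>
      intro x
      obtain ⟨_, ⟨i, rfl⟩, hi⟩ := Set.mem_iUnion₂.1 (hcov (Set.mem_univ x))
      exact ⟨i, (mem_ball.1 hi).le⟩
    | succ n ih =>
      intro x
      obtain ⟨y, rfl⟩ := hsurj n x
      obtain ⟨i, hi⟩ := ih y
      exact ⟨i, (hf n _ _).trans hi⟩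
  · have hanti : Antitone fun n => dist (p n i) (p n j) :=
      antitone_nat_of_succ_le fun n => hf n _ _
    exact (tendsto_atTop_ciInf hanti
      ⟨0, by rintro _ ⟨n, rfl⟩; exact dist_nonneg⟩).cauchySeq

/-- A `≼`-increasing sequence of nonempty compact metric spaces with a compact upper bound
converges. -/
theorem exists_tendsto_toGHSpace_of_monotone
    (X : ℕ → Type) [∀ n, MetricSpace (X n)] [∀ n, CompactSpace (X n)] [∀ n, Nonempty (X n)]
    (hX : ∀ n, DomOrder (X n) (X (n + 1)))
    (Y : Type) [MetricSpace Y] [CompactSpace Y] (hbdd : ∀ n, DomOrder (X n) Y) :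
    ∃ p : GHSpace, Tendsto (fun n => toGHSpace (X n)) atTop (𝓝 p) := by
  choose f hf hsurj using hX
  choose g hg gsurj using hbdd
  choose s hs using hsurj
  refine exists_tendsto_toGHSpace_of_cauchySeq_nets X fun ε hε => ?_
  let S : Set ℕ := {k | ∃ n, ∃ p : Fin k → X n, ∀ i j, i ≠ j → ε ≤ dist (p i) (p j)}
  have hS : BddAbove S := by
    obtain ⟨K, hK⟩ := exists_card_separated_le Y hε
    refine ⟨K, ?_⟩
    rintro k ⟨n, p, hp⟩
    choose q hq using fun i => gsurj n (p i)
    refine hK k q fun i j hij => (hp i j hij).trans ?_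
    simpa only [hq] using hg n (q i) (q j)
  -- A separated family of maximal cardinality among all the `X n` stays a net when lifted.
  obtain ⟨n₀, c, hc⟩ := Nat.sSup_mem (s := S) ⟨0, 0, Fin.elim0, fun i => i.elim0⟩ hS
  let p : ∀ n, Fin (sSup S) → X (n₀ + n) :=
    fun n => Nat.rec c (fun n q i => s (n₀ + n) (q i)) n
  have hmono : ∀ i j, Monotone fun n => dist (p n i) (p n j) := fun i j =>
    monotone_nat_of_le_succ fun n => by
      have h := hf (n₀ + n) (s (n₀ + n) (p n i)) (s (n₀ + n) (p n j))
      rwa [hs, hs] at h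
  refine ⟨n₀, sSup S, p, fun n x => ?_, fun i j => ?_⟩
  · by_contra! hx
    have hmem : sSup S + 1 ∈ S := by
      refine ⟨n₀ + n, Fin.cons x (p n), fun i j => ?_⟩
      refine Fin.cases ?_ (fun i => ?_) i <;> refine Fin.cases ?_ (fun j => ?_) j
      · exact fun h => (h rfl).elim
      · exact fun _ => (hx j).le
      · intro _
        simpa only [Fin.cons_zero, Fin.cons_succ, dist_comm] using (hx i).le
      · intro hij
        exact (hc i j fun h => hij (congrArg Fin.succ h)).trans (hmono i j (Nat.zero_le n))
    exact absurd (le_csSup hS hmem) (by omega)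
  · refine (tendsto_atTop_ciSup (hmono i j) ⟨diam (Set.univ : Set Y), ?_⟩).cauchySeq
    rintro _ ⟨n, rfl⟩
    obtain ⟨a, ha⟩ := gsurj _ (p n i)
    obtain ⟨b, hb⟩ := gsurj _ (p n j)
    change dist (p n i) (p n j) ≤ _
    rw [← ha, ← hb]
    exact (hg _ a b).trans
      (dist_le_diam_of_mem isCompact_univ.isBounded (Set.mem_univ a) (Set.mem_univ b))

/-- **Theorem.** A monotone (with respect to `≼`) and bounded (with respect to `≼`)
sequence of nonempty compact metric spaces converges in the Gromov–Hausdorff space. -/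
theorem monotone_bounded_sequence_converges_in_GHSpace
    (X : ℕ → Type) [∀ n, MetricSpace (X n)] [∀ n, CompactSpace (X n)] [∀ n, Nonempty (X n)]
    (hmono : (∀ n, DomOrder (X (n + 1)) (X n)) ∨ (∀ n, DomOrder (X n) (X (n + 1))))
    (Y : Type) [MetricSpace Y] [CompactSpace Y] [Nonempty Y]
    (hbdd : ∀ n, DomOrder (X n) Y) :
    ∃ p : GHSpace, Tendsto (fun n => toGHSpace (X n)) atTop (𝓝 p) := by
  rcases hmono with h | h
  · exact exists_tendsto_toGHSpace_of_antitone X h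
  · exact exists_tendsto_toGHSpace_of_monotone X h Y hbdd
end

section
/- Let X and Y be nonempty compact metric spaces such that there exists a bijective isometry from X onto Y. Then every non-expansive surjection f : X → Y is an isometry: dist (f x₁) (f x₂) = dist x₁ x₂ for all x₁, x₂ ∈ X. -/
/-- A non-expansive surjection of a compact metric space onto itself is an isometry. -/
theorem LipschitzWith.isometry_of_surjective {X : Type*} [PseudoMetricSpace X] [CompactSpace X]
    {h : X → X} (hh : LipschitzWith 1 h) (hsurj : Function.Surjective h) : Isometry h := by
  refine Isometry.of_dist_eq fun a b => le_antisymm (by simpa using hh.dist_le_mul a b) ?_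
  obtain ⟨s, hs⟩ := hsurj.hasRightInverse
  have hiter (m : ℕ) (x y : X) : dist (h^[m] x) (h^[m] y) ≤ dist x y := by
    simpa using (hh.iterate m).dist_le_mul x y
  -- The backward orbit of `(a, b)` comes back arbitrarily close to `(h a, h b)`.
  obtain ⟨p, φ, hφ, hlim⟩ :=
    CompactSpace.tendsto_subseq (fun n => (s^[n] a, s^[n] b))
  refine le_of_forall_pos_le_add fun ε hε => ?_
  obtain ⟨N, hN⟩ := Metric.cauchySeq_iff.1 hlim.cauchySeq (ε / 2) (half_pos hε)
  have hclose := hN (N + 1) N.le_succ N le_rfl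
  obtain ⟨j, hj⟩ := Nat.exists_eq_add_of_lt (hφ N.lt_succ_self)
  simp only [Function.comp_apply, Prod.dist_eq, max_lt_iff] at hclose
  have hreturn (x : X) : dist (s^[j] x) (h x) ≤ dist (s^[φ (N + 1)] x) (s^[φ N] x) := by
    have key := hiter (φ N + 1) (s^[φ (N + 1)] x) (s^[φ N] x)
    rwa [Function.iterate_succ_apply' h _ (s^[φ N] x), hs.iterate,
      show s^[φ (N + 1)] x = s^[φ N + 1] (s^[j] x) by
        rw [← Function.iterate_add_apply, hj, add_right_comm],
      hs.iterate, ← Function.iterate_add_apply, add_right_comm, ← hj] at key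
  have hexp : dist a b ≤ dist (s^[j] a) (s^[j] b) := by
    simpa only [hs.iterate j a, hs.iterate j b] using hiter j (s^[j] a) (s^[j] b)
  have htri := dist_triangle4 (s^[j] a) (h a) (h b) (s^[j] b)
  have hb := hreturn b
  rw [dist_comm] at hb
  linarith [hreturn a]

/-- **Proposition.** If there exists a bijective isometry between the nonempty compact
metric spaces `X` and `Y`, then every non-expansive surjection `f : X → Y` is an
isometry. -/
theorem nonexpansive_surjection_isometry_of_isometric
    (X : Type) [MetricSpace X] [CompactSpace X] [Nonempty X]
    (Y : Type) [MetricSpace Y] [CompactSpace Y] [Nonempty Y]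
    (hiso : ∃ g : X → Y, Function.Bijective g ∧ Isometry g)
    (f : X → Y)
    (hf_ne : ∀ a b : X, dist (f a) (f b) ≤ dist a b)
    (hf_surj : Function.Surjective f) :
    ∀ a b : X, dist (f a) (f b) = dist a b := by
  obtain ⟨g, hg, hgi⟩ := hiso
  let e := IsometryEquiv.mk (Equiv.ofBijective g hg) hgi
  have hLip : LipschitzWith 1 (e.symm ∘ f) := LipschitzWith.of_dist_le_mul fun a b => by
    simpa [e.symm.dist_eq] using hf_ne a b
  intro a b
  simpa [e.symm.dist_eq] using
    (hLip.isometry_of_surjective (e.symm.surjective.comp hf_surj)).dist_eq a b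
end

section
/- Let Σ be a nonempty directed partial order and let (X_σ, d_σ) and (Y_σ, ρ_σ), for σ ∈ Σ, be nonempty compact metric spaces such that the nets σ ↦ toGHSpace X_σ and σ ↦ toGHSpace Y_σ converge along atTop to toGHSpace X and toGHSpace Y respectively, where (X, d) and (Y, ρ) are nonempty compact metric spaces. Then there exist σ₀ ∈ Σ and r > 0 such that: (a) for every σ ≥ σ₀, the symmetric function ζ_σ on the disjoint union X_σ ⊔ Y_σ that restricts to d_σ on X_σ, to ρ_σ on Y_σ, and takes the constant value r on pairs consisting of one point of X_σ and one point of Y_σ, is a metric, and similarly the corresponding function ζ on X ⊔ Y is a metric; and (b) the net σ ↦ toGHSpace (X_σ ⊔ Y_σ, ζ_σ), defined for σ ≥ σ₀, converges to toGHSpace (X ⊔ Y, ζ). -/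
open GromovHausdorff Filter Topology

/-- The admissible distance with parameter `r` on the disjoint union `A ⊕ B`:
it restricts to the metrics of `A` and of `B` and equals `r` on mixed pairs. -/
def admissibleDist {A B : Type} [MetricSpace A] [MetricSpace B] (r : ℝ) :
    A ⊕ B → A ⊕ B → ℝ
  | Sum.inl a, Sum.inl a' => dist a a'
  | Sum.inl _, Sum.inr _ => r
  | Sum.inr _, Sum.inl _ => r
  | Sum.inr b, Sum.inr b' => dist b b'

/-- A symmetric distance function is a metric. -/
def IsMetricFun {Z : Type} (D : Z → Z → ℝ) : Prop :=
  (∀ p, D p p = 0) ∧ (∀ p q, D p q = 0 → p = q) ∧ (∀ p q, D p q = D q p) ∧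
  ∀ p q s, D p s ≤ D p q + D q s

/-- The metric space structure induced by a metric distance function. -/
noncomputable def metricOfFun {Z : Type} (D : Z → Z → ℝ) (h : IsMetricFun D) :
    MetricSpace Z where
  dist := D
  dist_self := h.1
  dist_comm := h.2.2.1
  dist_triangle := h.2.2.2
  eq_of_dist_eq_zero := fun {x y} hxy => h.2.1 x y hxy

/-- The topology induced by a metric distance function. -/
noncomputable def topOfFun {Z : Type} (D : Z → Z → ℝ) (h : IsMetricFun D) :
    TopologicalSpace Z :=
  (metricOfFun D h).toUniformSpace.toTopologicalSpace

theorem exists_map_of_dist_toGHSpace_lt {A B : Type} [MetricSpace A] [CompactSpace A] [Nonempty A]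
    [MetricSpace B] [CompactSpace B] [Nonempty B] {ε : ℝ}
    (h : dist (toGHSpace A) (toGHSpace B) < ε) :
    ∃ f : A → B, (∀ x y, |dist x y - dist (f x) (f y)| ≤ 2 * ε) ∧
      ∀ b, ∃ a, dist b (f a) ≤ 2 * ε := by
  obtain ⟨Φ, Ψ, hΦ, hΨ, hd⟩ := ghDist_eq_hausdorffDist A B
  have hlt : Metric.hausdorffDist (Set.range Φ) (Set.range Ψ) < ε := by
    rw [← hd]; exact h
  have hfin : Metric.hausdorffEDist (Set.range Φ) (Set.range Ψ) ≠ ⊤ :=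
    Metric.hausdorffEDist_ne_top_of_nonempty_of_bounded (Set.range_nonempty _)
      (Set.range_nonempty _) (isCompact_range hΦ.continuous).isBounded
      (isCompact_range hΨ.continuous).isBounded
  have hf : ∀ a, ∃ b, dist (Φ a) (Ψ b) < ε := fun a => by
    obtain ⟨_, ⟨b, rfl⟩, hb⟩ :=
      Metric.exists_dist_lt_of_hausdorffDist_lt (Set.mem_range_self a) hlt hfin
    exact ⟨b, hb⟩
  choose f hf using hf
  refine ⟨f, fun x y => ?_, fun b => ?_⟩
  · rw [← hΦ.dist_eq x y, ← hΨ.dist_eq (f x) (f y), ← Real.dist_eq]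
    have := dist_dist_dist_le (Φ x) (Φ y) (Ψ (f x)) (Ψ (f y))
    linarith [hf x, hf y]
  · obtain ⟨_, ⟨a, rfl⟩, ha⟩ :=
      Metric.exists_dist_lt_of_hausdorffDist_lt' (Set.mem_range_self b) hlt hfin
    refine ⟨a, ?_⟩
    rw [← hΨ.dist_eq]
    have := dist_triangle_left (Ψ b) (Ψ (f a)) (Φ a)
    linarith [hf a]

theorem isMetricFun_admissibleDist {A B : Type} [MetricSpace A] [MetricSpace B] {r : ℝ}
    (hr : 0 < r) (hA : ∀ x y : A, dist x y ≤ 2 * r) (hB : ∀ x y : B, dist x y ≤ 2 * r) :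
    IsMetricFun (admissibleDist (A := A) (B := B) r) := by
  refine ⟨?_, ?_, ?_, ?_⟩
  · rintro (a | b) <;> simp [admissibleDist]
  · rintro (a | b) (a' | b') <;> simp [admissibleDist, hr.ne']
  · rintro (a | b) (a' | b') <;> simp [admissibleDist, dist_comm]
  · rintro (a | b) (a' | b') (a'' | b'') <;> simp only [admissibleDist]
    · exact dist_triangle _ _ _
    · linarith [dist_nonneg (x := a) (y := a')]
    · linarith [hA a a'']
    · linarith [dist_nonneg (x := b') (y := b'')]
    · linarith [dist_nonneg (x := a') (y := a'')]
    · linarith [hB b b'']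
    · linarith [dist_nonneg (x := b) (y := b')]
    · exact dist_triangle _ _ _

theorem compactSpace_of_isometry_of_range_union {A B Z : Type*} [MetricSpace A] [CompactSpace A]
    [MetricSpace B] [CompactSpace B] [MetricSpace Z] {f : A → Z} {g : B → Z}
    (hf : Isometry f) (hg : Isometry g) (h : Set.range f ∪ Set.range g = Set.univ) :
    CompactSpace Z :=
  ⟨h ▸ (isCompact_range hf.continuous).union (isCompact_range hg.continuous)⟩

theorem compactSpace_admissibleDist {A B : Type} [MetricSpace A] [CompactSpace A]
    [MetricSpace B] [CompactSpace B] {r : ℝ}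
    (h : IsMetricFun (admissibleDist (A := A) (B := B) r)) :
    @CompactSpace (A ⊕ B) (topOfFun _ h) :=
  @compactSpace_of_isometry_of_range_union A B (A ⊕ B) _ _ _ _ (metricOfFun _ h) Sum.inl Sum.inr
    (@Isometry.of_dist_eq _ _ _ (metricOfFun _ h).toPseudoMetricSpace _ fun _ _ => rfl)
    (@Isometry.of_dist_eq _ _ _ (metricOfFun _ h).toPseudoMetricSpace _ fun _ _ => rfl)
    Set.range_inl_union_range_inr

theorem dist_toGHSpace_le_of_map {A B : Type} [MetricSpace A] [CompactSpace A] [Nonempty A]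
    [MetricSpace B] [CompactSpace B] [Nonempty B] {ε : ℝ} (f : A → B)
    (hf : ∀ x y, |dist x y - dist (f x) (f y)| ≤ 2 * ε) (hf' : ∀ b, ∃ a, dist b (f a) ≤ 2 * ε) :
    dist (toGHSpace A) (toGHSpace B) ≤ 3 * ε := by
  have key := ghDist_le_of_approx_subsets (s := Set.univ) (fun z => f z.1)
    (ε₁ := 0) (ε₂ := 2 * ε) (ε₃ := 2 * ε)
    (fun x => ⟨x, Set.mem_univ _, (dist_self x).le⟩)
    (fun b => (hf' b).imp' (fun a => ⟨a, Set.mem_univ a⟩) fun _ h => h)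
    (fun x y => hf x y)
  exact key.trans (by linarith)

theorem dist_toGHSpace_admissibleDist_le {A B A' B' : Type}
    [MetricSpace A] [CompactSpace A] [Nonempty A] [MetricSpace B] [CompactSpace B] [Nonempty B]
    [MetricSpace A'] [CompactSpace A'] [Nonempty A']
    [MetricSpace B'] [CompactSpace B'] [Nonempty B'] {r ε : ℝ}
    (hA : dist (toGHSpace A) (toGHSpace A') < ε) (hB : dist (toGHSpace B) (toGHSpace B') < ε)
    (hm : IsMetricFun (admissibleDist (A := A) (B := B) r))
    (hm' : IsMetricFun (admissibleDist (A := A') (B := B') r))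
    (hc : @CompactSpace (A ⊕ B) (topOfFun _ hm))
    (hc' : @CompactSpace (A' ⊕ B') (topOfFun _ hm')) (hn : Nonempty (A ⊕ B))
    (hn' : Nonempty (A' ⊕ B')) :
    dist (@toGHSpace (A ⊕ B) (metricOfFun _ hm) hc hn)
      (@toGHSpace (A' ⊕ B') (metricOfFun _ hm') hc' hn') ≤ 3 * ε := by
  have hε : 0 < ε := dist_nonneg.trans_lt hA
  obtain ⟨f, hf, hf'⟩ := exists_map_of_dist_toGHSpace_lt hA
  obtain ⟨g, hg, hg'⟩ := exists_map_of_dist_toGHSpace_lt hB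
  refine @dist_toGHSpace_le_of_map (A ⊕ B) (A' ⊕ B') (metricOfFun _ hm) hc hn
    (metricOfFun _ hm') hc' hn' ε (Sum.map f g) ?_ ?_
  · rintro (a | b) (a' | b')
    · exact hf a a'
    · change |r - r| ≤ 2 * ε
      simp [hε.le]
    · change |r - r| ≤ 2 * ε
      simp [hε.le]
    · exact hg b b'
  · rintro (a | b)
    · obtain ⟨x, hx⟩ := hf' a
      exact ⟨Sum.inl x, hx⟩
    · obtain ⟨x, hx⟩ := hg' b
      exact ⟨Sum.inr x, hx⟩

theorem dist_le_diam_add_of_dist_toGHSpace_lt {A B : Type} [MetricSpace A] [CompactSpace A]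
    [Nonempty A] [MetricSpace B] [CompactSpace B] [Nonempty B] {ε : ℝ}
    (h : dist (toGHSpace A) (toGHSpace B) < ε) (x y : A) :
    dist x y ≤ Metric.diam (Set.univ : Set B) + 2 * ε := by
  obtain ⟨f, hf, -⟩ := exists_map_of_dist_toGHSpace_lt h
  have := Metric.dist_le_diam_of_mem (isCompact_univ (X := B)).isBounded
    (Set.mem_univ (f x)) (Set.mem_univ (f y))
  linarith [(abs_le.mp (hf x y)).2]

/-- **Proposition (convergence of disjoint unions with admissible metrics).**
If the nets `σ ↦ X σ` and `σ ↦ Y σ` of nonempty compact metric spaces converge in the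
Gromov–Hausdorff space to `X∞` and `Y∞`, then there are `σ₀` and `r > 0` such that for
all `σ ≥ σ₀` the admissible distance with parameter `r` on `X σ ⊕ Y σ` (and on
`X∞ ⊕ Y∞`) is a metric, and the corresponding net of disjoint unions converges in the
Gromov–Hausdorff space to the disjoint union `X∞ ⊕ Y∞` with its admissible metric. -/
theorem disjoint_union_admissible_convergence
    (I : Type) [PartialOrder I] [IsDirected I (· ≤ ·)] [Nonempty I]
    (X : I → Type) [∀ σ, MetricSpace (X σ)] [∀ σ, CompactSpace (X σ)] [∀ σ, Nonempty (X σ)]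
    (Y : I → Type) [∀ σ, MetricSpace (Y σ)] [∀ σ, CompactSpace (Y σ)] [∀ σ, Nonempty (Y σ)]
    (X' : Type) [MetricSpace X'] [CompactSpace X'] [Nonempty X']
    (Y' : Type) [MetricSpace Y'] [CompactSpace Y'] [Nonempty Y']
    (hX : Tendsto (fun σ => toGHSpace (X σ)) atTop (𝓝 (toGHSpace X')))
    (hY : Tendsto (fun σ => toGHSpace (Y σ)) atTop (𝓝 (toGHSpace Y'))) :
    ∃ (σ₀ : I) (r : ℝ), 0 < r ∧
      ∃ (hm : ∀ σ : I, σ₀ ≤ σ → IsMetricFun (admissibleDist (A := X σ) (B := Y σ) r))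
        (hmL : IsMetricFun (admissibleDist (A := X') (B := Y') r))
        (hc : ∀ (σ : I) (h : σ₀ ≤ σ),
          @CompactSpace (X σ ⊕ Y σ) (topOfFun _ (hm σ h)))
        (hcL : @CompactSpace (X' ⊕ Y') (topOfFun _ hmL)),
        Tendsto
          (fun σ : {σ : I // σ₀ ≤ σ} =>
            @toGHSpace (X σ.1 ⊕ Y σ.1) (metricOfFun _ (hm σ.1 σ.2)) (hc σ.1 σ.2)
              ⟨Sum.inl (Classical.arbitrary _)⟩)
          atTop
          (𝓝 (@toGHSpace (X' ⊕ Y') (metricOfFun _ hmL) hcL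
            ⟨Sum.inl (Classical.arbitrary _)⟩)) := by
  have hXd := Metric.tendsto_nhds.mp hX
  have hYd := Metric.tendsto_nhds.mp hY
  obtain ⟨σ₀, hσ₀⟩ := eventually_atTop.mp ((hXd 1 one_pos).and (hYd 1 one_pos))
  have hdX : 0 ≤ Metric.diam (Set.univ : Set X') := Metric.diam_nonneg
  have hdY : 0 ≤ Metric.diam (Set.univ : Set Y') := Metric.diam_nonneg
  obtain ⟨r, hr⟩ : ∃ r, r = Metric.diam (Set.univ : Set X') +
    Metric.diam (Set.univ : Set Y') + 1 := ⟨_, rfl⟩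
  have hm : ∀ σ : I, σ₀ ≤ σ → IsMetricFun (admissibleDist (A := X σ) (B := Y σ) r) :=
    fun σ h => isMetricFun_admissibleDist (by linarith)
      (fun x y => by linarith [dist_le_diam_add_of_dist_toGHSpace_lt (hσ₀ σ h).1 x y])
      (fun x y => by linarith [dist_le_diam_add_of_dist_toGHSpace_lt (hσ₀ σ h).2 x y])
  have hmL : IsMetricFun (admissibleDist (A := X') (B := Y') r) :=
    isMetricFun_admissibleDist (by linarith)
      (fun x y => by
        linarith [Metric.dist_le_diam_of_mem (isCompact_univ (X := X')).isBounded
          (Set.mem_univ x) (Set.mem_univ y)])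
      (fun x y => by
        linarith [Metric.dist_le_diam_of_mem (isCompact_univ (X := Y')).isBounded
          (Set.mem_univ x) (Set.mem_univ y)])
  refine ⟨σ₀, r, by linarith, hm, hmL, fun σ h => compactSpace_admissibleDist (hm σ h),
    compactSpace_admissibleDist hmL, Metric.tendsto_nhds.mpr fun ε hε => ?_⟩
  obtain ⟨σ₁, hσ₁⟩ := eventually_atTop.mp
    ((hXd (ε / 4) (by positivity)).and (hYd (ε / 4) (by positivity)))
  obtain ⟨τ, hτ₀, hτ₁⟩ := exists_ge_ge σ₀ σ₁
  filter_upwards [eventually_ge_atTop (⟨τ, hτ₀⟩ : {σ : I // σ₀ ≤ σ})] with σ hσ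
  have hσ' := hσ₁ σ.1 (hτ₁.trans hσ)
  exact (dist_toGHSpace_admissibleDist_le hσ'.1 hσ'.2 (hm σ.1 σ.2) hmL _ _ _ _).trans_lt
    (by linarith)
end

section
/- For n ∈ ℕ, let X^n = {0, 1, …, n} (i.e. Fin (n+1)) with the discrete metric (dist x y = 1 for x ≠ y), and for m ≤ n let α_n^m : X^n → X^m be given by α_n^m(k) = k if k ≤ m and α_n^m(k) = 0 if k > m. These maps are non-expansive surjections forming an inverse system in cmn over ℕ, and this system has no inverse limit in cmn: there is no nonempty compact metric space X together with non-expansive maps α^n : X → X^n satisfying α_n^m ∘ α^n = α^m for m ≤ n and the universal property of the inverse limit. -/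
open Filter Topology

/-- The discrete metric on a type. -/
noncomputable def discreteMetric (Z : Type) [DecidableEq Z] : MetricSpace Z where
  dist x y := if x = y then 0 else 1
  dist_self x := if_pos rfl
  dist_comm x y := by
    show (if x = y then (0 : ℝ) else 1) = if y = x then (0 : ℝ) else 1
    by_cases h : x = y
    · simp [h]
    · rw [if_neg h, if_neg fun hyx => h hyx.symm]
  dist_triangle x y z := by
    show (if x = z then (0 : ℝ) else 1) ≤
      (if x = y then (0 : ℝ) else 1) + if y = z then (0 : ℝ) else 1
    split_ifs <;> simp_all
  eq_of_dist_eq_zero := by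
    intro x y h
    by_contra hxy
    change (if x = y then (0 : ℝ) else 1) = 0 at h
    rw [if_neg hxy] at h
    norm_num at h

/-- The objects of the inverse system: `X n = {0, 1, …, n}` with the discrete metric. -/
noncomputable instance (n : ℕ) : MetricSpace (Fin (n + 1)) := discreteMetric _

/-- The arrows of the inverse system: for `m ≤ n`, `k ↦ k` if `k ≤ m` and
`k ↦ 0` otherwise. -/
def truncMap (n m : ℕ) (k : Fin (n + 1)) : Fin (m + 1) :=
  if h : (k : ℕ) ≤ m then ⟨(k : ℕ), Nat.lt_succ_of_le h⟩ else 0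

theorem val_truncMap (n m : ℕ) (k : Fin (n + 1)) :
    (truncMap n m k : ℕ) = if (k : ℕ) ≤ m then (k : ℕ) else 0 := by
  unfold truncMap
  split_ifs <;> rfl

theorem truncMap_self (n : ℕ) (k : Fin (n + 1)) : truncMap n n k = k := by
  ext
  rw [val_truncMap, if_pos (Nat.lt_succ_iff.mp k.isLt)]

theorem truncMap_truncMap {m l : ℕ} (n : ℕ) (hml : m ≤ l) (k : Fin (n + 1)) :
    truncMap l m (truncMap n l k) = truncMap n m k := by
  ext
  simp only [val_truncMap]
  split_ifs <;> omega

theorem truncMap_surjective {m n : ℕ} (hmn : m ≤ n) : Function.Surjective (truncMap n m) := by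
  intro k
  refine ⟨⟨k, by omega⟩, ?_⟩
  ext
  rw [val_truncMap, if_pos (Nat.lt_succ_iff.mp k.isLt)]

theorem dist_fin_eq (n : ℕ) (a b : Fin (n + 1)) : dist a b = if a = b then 0 else 1 := rfl

theorem dist_truncMap_le (n m : ℕ) (a b : Fin (n + 1)) :
    dist (truncMap n m a) (truncMap n m b) ≤ dist a b := by
  by_cases hab : a = b
  · simp [hab]
  · rw [dist_fin_eq, dist_fin_eq, if_neg hab]
    split_ifs <;> norm_num

/-- A compact metric space contains no sequence that is uniformly separated. -/
theorem not_forall_le_dist_of_compactSpace {X : Type*} [MetricSpace X] [CompactSpace X]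
    {ε : ℝ} (hε : 0 < ε) (p : ℕ → X) : ¬ ∀ j k, j < k → ε ≤ dist (p j) (p k) := by
  intro hp
  obtain ⟨x, φ, hφ, hx⟩ := CompactSpace.tendsto_subseq p
  obtain ⟨N, hN⟩ := Metric.cauchySeq_iff.mp hx.cauchySeq ε hε
  exact (hp _ _ (hφ N.lt_succ_self)).not_gt (hN N le_rfl (N + 1) N.le_succ)

/-- **Example (an inverse system in cmn with no inverse limit).**
The maps `truncMap n m : Fin (n+1) → Fin (m+1)` (for `m ≤ n`), between the spaces
`{0, 1, …, n}` with discrete metrics, are non-expansive surjections forming an inverse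
system in cmn, and this system has no inverse limit in cmn. -/
theorem truncation_inverse_system_has_no_inverse_limit :
    (∀ (m n : ℕ), m ≤ n → ∀ a b : Fin (n + 1),
      dist (truncMap n m a) (truncMap n m b) ≤ dist a b) ∧
    (∀ (m n : ℕ), m ≤ n → Function.Surjective (truncMap n m)) ∧
    (∀ (n : ℕ) (k : Fin (n + 1)), truncMap n n k = k) ∧
    (∀ (m l n : ℕ), m ≤ l → l ≤ n → ∀ k : Fin (n + 1),
      truncMap l m (truncMap n l k) = truncMap n m k) ∧
    ¬ ∃ (L : Type) (_ : MetricSpace L) (_ : CompactSpace L) (_ : Nonempty L)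
        (f : ∀ n : ℕ, L → Fin (n + 1)),
        (∀ n, ∀ a b : L, dist (f n a) (f n b) ≤ dist a b) ∧
        (∀ (m n : ℕ), m ≤ n → ∀ x : L, truncMap n m (f n x) = f m x) ∧
        (∀ (Z : Type) (_ : MetricSpace Z) (_ : CompactSpace Z) (_ : Nonempty Z)
          (ξ : ∀ n : ℕ, Z → Fin (n + 1)),
          (∀ n, ∀ a b : Z, dist (ξ n a) (ξ n b) ≤ dist a b) →
          (∀ (m n : ℕ), m ≤ n → ∀ z : Z, truncMap n m (ξ n z) = ξ m z) →
          ∃! ν : Z → L,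
            (∀ a b : Z, dist (ν a) (ν b) ≤ dist a b) ∧
            ∀ (n : ℕ) (z : Z), f n (ν z) = ξ n z) := by
  refine ⟨fun m n _ => dist_truncMap_le n m, fun _ _ => truncMap_surjective, truncMap_self,
    fun _ _ n hml _ => truncMap_truncMap n hml, ?_⟩
  rintro ⟨L, _, _, _, f, hf, -, hL⟩
  have hpoint : ∀ k : ℕ, ∃ x : L, ∀ n, f n x = truncMap k n (Fin.last k) := by
    intro k
    obtain ⟨ν, ⟨-, hν⟩, -⟩ := hL Unit inferInstance inferInstance inferInstance
      (fun n _ => truncMap k n (Fin.last k)) (fun n a b => by simp)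
      (fun m n hmn _ => truncMap_truncMap k hmn _)
    exact ⟨ν (), fun n => hν n ()⟩
  choose p hp using hpoint
  refine not_forall_le_dist_of_compactSpace one_pos p fun j k hjk => ?_
  have hne : f k (p j) ≠ f k (p k) := by
    rw [hp, hp, ne_eq, Fin.ext_iff, val_truncMap, val_truncMap]
    simp [hjk.le, hjk.ne]
  have hle := hf k (p j) (p k)
  rwa [dist_fin_eq, if_neg hne] at hle
end
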